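/- arXiv:math/0407152 — 2 statements merged into one kernel-verified Lean document; each statement's English description precedes it below -/
import Mathlib

section
/- The assignment J ↦ J ∩ G_{m,n} defines a bijective correspondence between Spec_n(T_{m,n}) and Spec_n(G_{m,n}). In addition, for any prime ideal J ∈ Spec_n(T_{m,n}): (a) the natural projection T_{m,n} → T_{m,n}/J is trace-preserving, and T_{m,n}/J is the trace ring of G_{m,n}/(J ∩ G_{m,n}); and (b) tr(p) ∈ J for every p ∈ J. -/
set_option linter.unusedSectionVars false

noncomputable section

universe u

-- Throughout, `k` is an algebraically closed base field of characteristic zero.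
variable (k : Type) [Field k] [IsAlgClosed k] [CharZero k]

/-- Index type for the `m·n²` commuting variables `x_{ij}^{(h)}`. -/
abbrev MIdx (n m : ℕ) := Fin m × Fin n × Fin n

/-- The commutative polynomial ring `k[x_{ij}^{(h)}]`. -/
abbrev PolyRing (n m : ℕ) := MvPolynomial (MIdx n m) k

/-- Matrices over the polynomial ring `k[x_{ij}^{(h)}]`. -/
abbrev MatPoly (n m : ℕ) := Matrix (Fin n) (Fin n) (PolyRing k n m)

/-- The space `(M_n)^m` of `m`-tuples of `n×n` matrices over `k`. -/
abbrev MTuple (n m : ℕ) := Fin m → Matrix (Fin n) (Fin n) k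

/-- The `h`-th generic `n×n` matrix `X_h = (x_{ij}^{(h)})`. -/
def genericMatrix (n m : ℕ) (h : Fin m) : MatPoly k n m :=
  Matrix.of fun i j => MvPolynomial.X (h, i, j)

/-- `G_{m,n}`, the algebra of `m` generic `n×n` matrices: the `k`-subalgebra of
`M_n(k[x_{ij}^{(h)}])` generated by the generic matrices. -/
def GMN (n m : ℕ) : Subalgebra k (MatPoly k n m) :=
  Algebra.adjoin k (Set.range (genericMatrix k n m))

/-- Evaluation of the commuting variables at a point `a ∈ (M_n)^m`. -/
def polyEval {n m : ℕ} (a : MTuple k n m) : PolyRing k n m →ₐ[k] k :=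
  MvPolynomial.aeval fun x : MIdx n m => a x.1 x.2.1 x.2.2

/-- Evaluation of matrix-valued polynomials at a point `a ∈ (M_n)^m`; under this
map an element of `G_{m,n}` (or `T_{m,n}`) becomes a `PGL_n`-equivariant polynomial
map `(M_n)^m → M_n`. -/
def evalMat {n m : ℕ} (a : MTuple k n m) :
    MatPoly k n m →ₐ[k] Matrix (Fin n) (Fin n) k :=
  (polyEval k a).mapMatrix

/-- The scalar matrix `tr(p)·1 ∈ M_n(k[x_{ij}^{(h)}])`. -/
def traceScalar {n m : ℕ} (p : MatPoly k n m) : MatPoly k n m :=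
  algebraMap (PolyRing k n m) (MatPoly k n m) (Matrix.trace p)

/-- `T_{m,n}`, the trace ring of `G_{m,n}`: the `k`-algebra generated inside
`M_n(k[x_{ij}^{(h)}])` by `G_{m,n}` together with the traces of its elements. -/
def TMN (n m : ℕ) : Subalgebra k (MatPoly k n m) :=
  Algebra.adjoin k ((GMN k n m : Set (MatPoly k n m)) ∪
    (traceScalar k '' (GMN k n m : Set (MatPoly k n m))))

lemma GMN_le_TMN (n m : ℕ) : GMN k n m ≤ TMN k n m :=
  fun _ hx => Algebra.subset_adjoin (Or.inl hx)

/-- The inclusion `G_{m,n} → T_{m,n}`. -/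
def inclGT (n m : ℕ) : ↥(GMN k n m) →+* ↥(TMN k n m) :=
  (Subalgebra.inclusion (GMN_le_TMN k n m) : ↥(GMN k n m) →ₐ[k] ↥(TMN k n m)).toRingHom

/-- `U_{m,n}`: the set of `m`-tuples of `n×n` matrices generating `M_n` as a
`k`-algebra. -/
def genTuples (n m : ℕ) : Set (MTuple k n m) :=
  {a | Algebra.adjoin k (Set.range a) = ⊤}

/-- Simultaneous conjugation of an `m`-tuple by `g ∈ GL_n(k)`; since scalar
matrices act trivially, this is the `PGL_n`-action on `(M_n)^m`. -/
def conjAct {n m : ℕ} (g : GL (Fin n) k) (a : MTuple k n m) : MTuple k n m :=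
  fun i =>
    (g : Matrix (Fin n) (Fin n) k) * a i * ((g⁻¹ : GL (Fin n) k) : Matrix (Fin n) (Fin n) k)

/-- Zariski closed subsets of `(M_n)^m`. -/
def IsZClosed {n m : ℕ} (C : Set (MTuple k n m)) : Prop :=
  ∃ S : Set (PolyRing k n m), C = {a | ∀ p ∈ S, polyEval k a p = 0}

/-- `X` is an `n`-variety: a closed `PGL_n`-invariant subvariety of `U_{m,n}`,
i.e. `X = X̄ ∩ U_{m,n}` where `X̄` is the Zariski closure of `X` in `(M_n)^m`. -/
def IsNVariety {n m : ℕ} (X : Set (MTuple k n m)) : Prop :=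
  X ⊆ genTuples k n m ∧
  (∀ g : GL (Fin n) k, ∀ a ∈ X, conjAct k g a ∈ X) ∧
  ∃ C, IsZClosed k C ∧ X = C ∩ genTuples k n m

/-- Irreducibility of a subset of `(M_n)^m` with respect to the Zariski topology. -/
def IsIrredSubset {n m : ℕ} (X : Set (MTuple k n m)) : Prop :=
  X.Nonempty ∧ ∀ C₁ C₂ : Set (MTuple k n m), IsZClosed k C₁ → IsZClosed k C₂ →
    X ⊆ C₁ ∪ C₂ → X ⊆ C₁ ∨ X ⊆ C₂

/-- The zero locus in `U_{m,n}` of a set of matrix-valued polynomials. -/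
def zeroLocus {n m : ℕ} (S : Set (MatPoly k n m)) : Set (MTuple k n m) :=
  {a | a ∈ genTuples k n m ∧ ∀ p ∈ S, evalMat k a p = 0}

/-- The zero locus in `U_{m,n}` of a two-sided ideal of a subalgebra `A` of
`M_n(k[x_{ij}^{(h)}])` (such as `G_{m,n}` or `T_{m,n}`). -/
def zeroLocusI {n m : ℕ} {A : Subalgebra k (MatPoly k n m)} (J : TwoSidedIdeal ↥A) :
    Set (MTuple k n m) :=
  {a | a ∈ genTuples k n m ∧ ∀ p : ↥A, p ∈ J → evalMat k a (p : MatPoly k n m) = 0}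

/-- The vanishing (two-sided) ideal of a subset `X ⊆ (M_n)^m` in a subalgebra `A`
of `M_n(k[x_{ij}^{(h)}])`; for `A = G_{m,n}` this is `I(X)`, for `A = T_{m,n}`
this is `I_T(X)`. -/
def vanishIdeal {n m : ℕ} (A : Subalgebra k (MatPoly k n m)) (X : Set (MTuple k n m)) :
    TwoSidedIdeal ↥A :=
  TwoSidedIdeal.mk' {p : ↥A | ∀ a ∈ X, evalMat k a (p : MatPoly k n m) = 0}
    (fun a _ => by simp)
    (fun {p q} hp hq a ha => by
      have : ((p + q : ↥A) : MatPoly k n m) = (p : MatPoly k n m) + q := rfl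
      simp [this, map_add, hp a ha, hq a ha])
    (fun {p} hp a ha => by
      have : ((-p : ↥A) : MatPoly k n m) = -(p : MatPoly k n m) := rfl
      simp [this, map_neg, hp a ha])
    (fun {p q} hq a ha => by
      have : ((p * q : ↥A) : MatPoly k n m) = (p : MatPoly k n m) * q := rfl
      simp [this, map_mul, hq a ha])
    (fun {p q} hp a ha => by
      have : ((p * q : ↥A) : MatPoly k n m) = (p : MatPoly k n m) * q := rfl
      simp [this, map_mul, hp a ha])

/-- Restriction: a matrix-valued polynomial gives an `M_n`-valued function on `X`. -/
def restrictTo {n m : ℕ} (X : Set (MTuple k n m)) :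
    MatPoly k n m →ₐ[k] (X → Matrix (Fin n) (Fin n) k) :=
  Pi.algHom k _ fun a => evalMat k a.val

/-- The PI-coordinate ring `k_n[X] = G_{m,n}/I(X)`, realized concretely as the
algebra of all restrictions to `X` of elements of `G_{m,n}` (i.e. of
`PGL_n`-equivariant morphisms `X → M_n` coming from `G_{m,n}`). -/
def coordRing {n m : ℕ} (X : Set (MTuple k n m)) :
    Subalgebra k (X → Matrix (Fin n) (Fin n) k) :=
  (GMN k n m).map (restrictTo k X)

/-- The ring `T_{m,n}/I_T(X)`, realized concretely as the algebra of all
restrictions to `X` of elements of `T_{m,n}`. -/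
def coordTraceRing {n m : ℕ} (X : Set (MTuple k n m)) :
    Subalgebra k (X → Matrix (Fin n) (Fin n) k) :=
  (TMN k n m).map (restrictTo k X)

/-- A ring is prime if it is nonzero and `a·R·b = 0` implies `a = 0` or `b = 0`. -/
def IsPrimeRing (R : Type u) [Ring R] : Prop :=
  Nontrivial R ∧ ∀ a b : R, (∀ x : R, a * x * b = 0) → a = 0 ∨ b = 0

/-- `Q` is a central simple algebra of degree `n`: a simple ring whose center is a
field, and which has dimension `n²` over its center. -/
def IsCSAOfDegree (n : ℕ) (Q : Type u) [Ring Q] : Prop :=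
  IsSimpleRing Q ∧
  ∃ (K : Type u) (_ : Field K) (_ : Algebra K Q),
    (algebraMap K Q).range = Subring.center Q ∧ Module.finrank K Q = n ^ 2

/-- A (prime PI-) ring `R` has PI-degree `n` if its total ring of fractions — the
central localization of `R` at its nonzero central elements — is a central simple
algebra of degree `n`. -/
def HasPIDegree (n : ℕ) (R : Type u) [Ring R] : Prop :=
  ∃ (Q : Type u) (_ : Ring Q) (f : R →+* Q),
    Function.Injective f ∧
    (∀ c ∈ Subring.center R, c ≠ 0 → IsUnit (f c)) ∧
    (∀ q : Q, ∃ r : R, ∃ c ∈ Subring.center R, c ≠ 0 ∧ q * f c = f r) ∧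
    IsCSAOfDegree n Q

/-- The quotient of a ring by a two-sided ideal. -/
abbrev idealQuot {R : Type u} [Ring R] (J : TwoSidedIdeal R) : Type u := J.ringCon.Quotient

/-- `Spec_n(R)`: the set of prime (two-sided) ideals `J` of `R` such that `R/J` is a
prime ring of PI-degree `n`. -/
def SpecN (n : ℕ) (R : Type u) [Ring R] : Set (TwoSidedIdeal R) :=
  {J | IsPrimeRing (idealQuot J) ∧ HasPIDegree n (idealQuot J)}

/-- A regular map of `n`-varieties `X → Y ⊆ U_{l,n}`: a map of the form
`a ↦ (f₁(a), …, f_l(a))` with each `f_i ∈ k_n[X]`, i.e. each component is the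
restriction to `X` of an element of `G_{m,n}`. -/
def IsRegMapOn {n m l : ℕ} (X : Set (MTuple k n m)) (Y : Set (MTuple k n l))
    (φ : MTuple k n m → MTuple k n l) : Prop :=
  (∀ a ∈ X, φ a ∈ Y) ∧
  ∃ F : Fin l → MatPoly k n m, (∀ i, F i ∈ GMN k n m) ∧
    ∀ a ∈ X, ∀ i, φ a i = evalMat k a (F i)

/-- `X` and `Y` are isomorphic `n`-varieties: there are mutually inverse regular
maps of `n`-varieties between them. -/
def NIsomorphic {n m l : ℕ} (X : Set (MTuple k n m)) (Y : Set (MTuple k n l)) : Prop :=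
  ∃ (φ : MTuple k n m → MTuple k n l) (ψ : MTuple k n l → MTuple k n m),
    IsRegMapOn k X Y φ ∧ IsRegMapOn k Y X ψ ∧
    (∀ a ∈ X, ψ (φ a) = a) ∧ (∀ b ∈ Y, φ (ψ b) = b)



section
open Matrix

theorem tr_path_sum {C : Type*} [CommRing C] {n : ℕ} : ∀ (l : ℕ) (M : Fin l → Matrix (Fin n) (Fin n) C)
    (p q : Fin n), (List.ofFn M).prod p q =
      ∑ s : Fin (l+1) → Fin n, if s 0 = p ∧ s (Fin.last l) = q then
        ∏ i : Fin l, M i (s i.castSucc) (s i.succ) else 0 := by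
  intro l
  induction l with
  | zero =>
    intro M p q
    rw [← (Equiv.funUnique (Fin 1) (Fin n)).symm.sum_comp]
    simp [Matrix.one_apply, Finset.sum_ite, Finset.filter_and, Finset.filter_eq']
    split_ifs with h
    · subst h; simp
    · rw [Finset.inter_comm]; simp [h]
      
  | succ l ih =>
    intro M p q
    rw [List.ofFn_succ, List.prod_cons, Matrix.mul_apply]
    simp_rw [ih]
    rw [← (Fin.consEquiv (fun _ : Fin (l+2) => Fin n)).sum_comp, Fintype.sum_prod_type]
    symm
    rw [Finset.sum_eq_single p]
    · simp_rw [Finset.mul_sum]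
      symm
      rw [Finset.sum_comm]
      refine Finset.sum_congr rfl fun s _ => ?_
      rw [Finset.sum_eq_single (s 0)]
      · simp [Fin.consEquiv, Fin.prod_univ_succ, ← Fin.succ_last, -Fin.succ_last]
      · intro b _ hb
        rw [if_neg (fun h => hb h.1.symm)]; simp
      · simp
    · intro b _ hb
      refine Finset.sum_eq_zero fun s _ => ?_
      simp [Fin.consEquiv, hb]
    · simp

/-- exponent-weighted ordered product -/
noncomputable def fmon {A : Type*} [Ring A] {n : ℕ} (x : A) (y : Fin n → A)
    (σ τ : Equiv.Perm (Fin n)) : A :=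
  (List.ofFn fun i : Fin n => x ^ ((σ i : Fin n) : ℕ) * y i * x ^ ((τ i : Fin n) : ℕ)).prod

/-- Half of Formanek's polynomial. -/
noncomputable def fhalf {A : Type*} [Ring A] {n : ℕ} (x : A) (y : Fin n → A) : A :=
  ∑ σ : Equiv.Perm (Fin n), ∑ τ : Equiv.Perm (Fin n),
    ((Equiv.Perm.sign σ : ℤ) * (Equiv.Perm.sign τ : ℤ)) • fmon x y σ τ

/-- Formanek's central polynomial. -/
noncomputable def formanek {A : Type*} [Ring A] {n : ℕ} [NeZero n] (x : A) (y : Fin n → A) : A :=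
  ∑ r : Fin n, fhalf x (fun i => y (i + r))

theorem fhalf_map {A B : Type*} [Ring A] [Ring B] (f : A →+* B) {n : ℕ} (x : A) (y : Fin n → A) :
    f (fhalf x y) = fhalf (f x) (fun i => f (y i)) := by
  simp [fhalf, fmon, map_list_prod, List.map_ofFn, Function.comp_def]

theorem formanek_map {A B : Type*} [Ring A] [Ring B] (f : A →+* B) {n : ℕ} [NeZero n]
    (x : A) (y : Fin n → A) :
    f (formanek x y) = formanek (f x) (fun i => f (y i)) := by
  simp [formanek, fhalf_map]

theorem fhalf_entry {C : Type*} [CommRing C] {n : ℕ} (lam : Fin n → C)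
    (y : Fin n → Matrix (Fin n) (Fin n) C) (p q : Fin n) :
    fhalf (Matrix.diagonal lam) y p q =
      ∑ s : Fin (n+1) → Fin n, if s 0 = p ∧ s (Fin.last n) = q then
        (∏ i : Fin n, y i (s i.castSucc) (s i.succ)) *
        ((Matrix.vandermonde (fun i : Fin n => lam (s i.castSucc))).det *
        (Matrix.vandermonde (fun i : Fin n => lam (s i.succ))).det) else 0 := by
  have key : ∀ σ τ : Equiv.Perm (Fin n), fmon (Matrix.diagonal lam) y σ τ p q =
      ∑ s : Fin (n+1) → Fin n, if s 0 = p ∧ s (Fin.last n) = q then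
        (∏ i : Fin n, y i (s i.castSucc) (s i.succ)) *
          ((∏ i : Fin n, lam (s i.castSucc) ^ ((σ i : Fin n) : ℕ)) *
           (∏ i : Fin n, lam (s i.succ) ^ ((τ i : Fin n) : ℕ))) else 0 := by
    intro σ τ
    rw [fmon, tr_path_sum]
    refine Finset.sum_congr rfl fun s _ => ?_
    split_ifs
    · rw [← Finset.prod_mul_distrib, ← Finset.prod_mul_distrib]
      refine Finset.prod_congr rfl fun i _ => ?_
      simp [Matrix.diagonal_pow, Matrix.diagonal_mul, Matrix.mul_diagonal]
      ring
    · rfl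
  simp only [fhalf, Matrix.sum_apply, Matrix.smul_apply, key, Finset.smul_sum]
  simp_rw [Finset.sum_comm (s := (Finset.univ : Finset (Equiv.Perm (Fin n)))) (t := (Finset.univ : Finset (Fin (n+1) → Fin n)))]
  refine Finset.sum_congr rfl fun s _ => ?_
  split_ifs with h
  · rw [← Matrix.det_transpose (M := vandermonde fun i => lam (s i.castSucc)),
      ← Matrix.det_transpose (M := vandermonde fun i => lam (s i.succ)),
      Matrix.det_apply', Matrix.det_apply', Finset.sum_mul_sum, Finset.mul_sum]
    refine Finset.sum_congr rfl fun σ _ => ?_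
    rw [Finset.mul_sum]
    refine Finset.sum_congr rfl fun τ _ => ?_
    simp [Matrix.vandermonde, zsmul_eq_mul]
    ring
  · simp

/-- the multilinear scalar -/
noncomputable def fmu {C : Type*} [CommRing C] {n : ℕ} [NeZero n] :
    MultilinearMap C (fun _ : Fin n => Matrix (Fin n) (Fin n) C) C :=
  ∑ σ : Equiv.Perm (Fin n), (MultilinearMap.mkPiAlgebra C (Fin n) C).compLinearMap
    (fun i => Matrix.entryLinearMap C C (σ i) (σ (i+1)))

theorem fmu_apply {C : Type*} [CommRing C] {n : ℕ} [NeZero n] (y : Fin n → Matrix (Fin n) (Fin n) C) :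
    fmu y = ∑ σ : Equiv.Perm (Fin n), ∏ i, y i (σ i) (σ (i+1)) := by
  simp [fmu]

theorem fmu_ne_zero {C : Type*} [CommRing C] [Nontrivial C] {n : ℕ} [NeZero n] :
    (fmu : MultilinearMap C (fun _ : Fin n => Matrix (Fin n) (Fin n) C) C) ≠ 0 := by
  intro h
  have : fmu (fun i : Fin n => Matrix.single i (i+1) (1:C)) = 1 := by
    rw [fmu_apply, Finset.sum_eq_single 1]
    · simp
    · intro σ _ hσ
      obtain ⟨i, hi⟩ : ∃ i, σ i ≠ i := by
        by_contra hc; push Not at hc; exact hσ (Equiv.ext hc)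
      refine Finset.prod_eq_zero (Finset.mem_univ i) ?_
      simp [Matrix.single_apply, Ne.symm hi]
    · simp
  rw [h] at this
  simp at this

theorem fhalf_entry' {C : Type*} [Field C] {n : ℕ} [NeZero n] (lam : Fin n → C) :
    ∃ κ : C, (Function.Injective lam → κ ≠ 0) ∧ ∀ (y : Fin n → Matrix (Fin n) (Fin n) C) (p q : Fin n),
    fhalf (Matrix.diagonal lam) y p q = κ *
      ∑ σ : Equiv.Perm (Fin n), if σ 0 = p ∧ σ 0 = q then ∏ i, y i (σ i) (σ (i+1)) else 0 := by
  obtain ⟨m, rfl⟩ : ∃ m, n = m + 1 := ⟨n - 1, by have := NeZero.pos n; omega⟩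
  set V := (Matrix.vandermonde lam).det with hV
  have hperm : ∀ σ : Equiv.Perm (Fin (m+1)),
      (Matrix.vandermonde (fun i => lam (σ i))).det = ((Equiv.Perm.sign σ : ℤ) : C) * V := by
    intro σ
    rw [hV, ← Matrix.det_permute]; rfl
  let rot : Equiv.Perm (Fin (m+1)) := Equiv.addRight 1
  let ext : Equiv.Perm (Fin (m+1)) → (Fin (m+2) → Fin (m+1)) :=
    fun σ => Fin.snoc (α := fun _ => Fin (m+1)) (fun i => σ i) (σ 0)
  have hext1 : ∀ σ i, ext σ (Fin.castSucc i) = σ i := fun σ i => by simp [ext]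
  have hext2 : ∀ σ i, ext σ (Fin.succ i) = σ (i + 1) := fun σ i => by
    induction i using Fin.lastCases with
    | last => simp [ext, ← Fin.succ_last, -Fin.succ_last]; simp
    | cast j =>
      rw [Fin.succ_castSucc, hext1, Fin.coeSucc_eq_succ]
  refine ⟨((Equiv.Perm.sign rot : ℤ) : C) * V ^ 2, ?_, ?_⟩
  · intro hl
    refine mul_ne_zero ?_ (pow_ne_zero _ (Matrix.det_vandermonde_ne_zero_iff.2 hl))
    rcases Int.units_eq_one_or (Equiv.Perm.sign rot) with h | h <;> simp [h]
  · intro y p q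
    rw [fhalf_entry, Finset.mul_sum]
    symm
    refine Finset.sum_of_injOn ext ?_ (fun _ _ => Finset.mem_coe.2 (Finset.mem_univ _)) ?_ ?_
    · intro σ _ τ _ h
      ext1 i
      rw [← hext1, ← hext1]; exact congrFun h _
    · intro s _ hs
      split_ifs with h
      · by_contra hne
        have h1 := right_ne_zero_of_mul hne
        have h2 := left_ne_zero_of_mul h1
        have h3 := right_ne_zero_of_mul h1
        have i1 : Function.Injective (fun i : Fin (m+1) => s i.castSucc) :=
          Function.Injective.of_comp (Matrix.det_vandermonde_ne_zero_iff.1 h2 : Function.Injective (lam ∘ fun i : Fin (m+1) => s i.castSucc))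
        have i2 : Function.Injective (fun i : Fin (m+1) => s i.succ) :=
          Function.Injective.of_comp (Matrix.det_vandermonde_ne_zero_iff.1 h3 : Function.Injective (lam ∘ fun i : Fin (m+1) => s i.succ))
        apply hs
        let σ : Equiv.Perm (Fin (m+1)) := Equiv.ofBijective _ (Finite.injective_iff_bijective.1 i1)
        refine ⟨σ, by simp, ?_⟩
        have hσ : ∀ i, σ i = s i.castSucc := fun i => rfl
        funext j
        induction j using Fin.lastCases with
        | cast j => rw [hext1]; rfl
        | last =>
          have : ext σ (Fin.last (m+1)) = s 0 := by simp [ext, hσ]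
          rw [this]
          obtain ⟨j, hj⟩ := (Finite.injective_iff_surjective.1 i2) (s 0)
          simp only at hj
          induction j using Fin.lastCases with
          | last => rw [← hj]; simp
          | cast j =>
            rw [Fin.succ_castSucc] at hj
            have := @i1 j.succ 0 (by simpa using hj)
            simp at this
      · rfl
    · intro σ _
      have e0 : ext σ 0 = σ 0 := hext1 σ 0
      have el : ext σ (Fin.last (m+1)) = σ 0 := by simp [ext]
      rw [e0, el]
      simp only [hext1, hext2]
      have h2 := hperm (rot.trans σ)
      have : (fun i => lam ((rot.trans σ) i)) = fun i => lam (σ (i+1)) := rfl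
      rw [this] at h2
      rw [hperm σ, h2]
      split_ifs
      · have : Equiv.Perm.sign (rot.trans σ) = Equiv.Perm.sign σ * Equiv.Perm.sign rot := by
          rw [← Equiv.Perm.sign_mul]; rfl
        rw [this]
        have hs : ((Equiv.Perm.sign σ : ℤ) : C) * ((Equiv.Perm.sign σ : ℤ) : C) = 1 := by
          rcases Int.units_eq_one_or (Equiv.Perm.sign σ) with h | h <;> simp [h]
        push_cast
        linear_combination (-(∏ i, y i (σ i) (σ (i+1))) * V^2 * ((Equiv.Perm.sign rot : ℤ) : C)) * hs
      · simp

theorem formanek_diag {C : Type*} [Field C] {n : ℕ} [NeZero n] (lam : Fin n → C)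
    (hl : Function.Injective lam) :
    ∃ κ : C, κ ≠ 0 ∧ ∀ (y : Fin n → Matrix (Fin n) (Fin n) C),
      formanek (Matrix.diagonal lam) y = (κ * fmu y) • (1 : Matrix (Fin n) (Fin n) C) := by
  obtain ⟨κ, h1, h2⟩ := fhalf_entry' lam
  refine ⟨κ, h1 hl, fun y => ?_⟩
  ext p q
  rw [formanek, Matrix.sum_apply]
  simp only [h2]
  rw [← Finset.mul_sum, Matrix.smul_apply, smul_eq_mul, mul_assoc]
  congr 1
  rw [fmu_apply]
  have : ∀ r : Fin n, (∑ σ : Equiv.Perm (Fin n), if σ 0 = p ∧ σ 0 = q then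
      ∏ i, y (i + r) (σ i) (σ (i+1)) else 0) = ∑ σ : Equiv.Perm (Fin n), if σ r = p ∧ σ r = q then
      ∏ i, y i (σ i) (σ (i+1)) else 0 := by
    intro r
    rw [← Equiv.sum_comp (Equiv.mulRight (Equiv.addRight r : Equiv.Perm (Fin n)))]
    refine Finset.sum_congr rfl fun σ _ => ?_
    simp only [Equiv.coe_mulRight, Equiv.Perm.mul_apply, Equiv.coe_addRight, zero_add]
    rw [← Equiv.prod_comp (Equiv.addRight r : Fin n ≃ Fin n) (fun i => y i (σ i) (σ (i+1)))]
    simp only [Equiv.coe_addRight, add_right_comm]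
  simp_rw [this]
  rw [Finset.sum_comm, Finset.sum_mul]
  refine Finset.sum_congr rfl fun σ _ => ?_
  rw [Finset.sum_eq_single (σ.symm p)]
  · by_cases h : p = q
    · subst h; simp
    · simp [h]
  · intro b _ hb
    rw [if_neg]
    rintro ⟨h, -⟩
    exact hb (by simp [← h])
  · simp
end

section
open Matrix

/-- discriminant-like polynomial function -/
noncomputable def cdisc {R : Type*} [CommRing R] {n : ℕ} (M : Matrix (Fin n) (Fin n) R) : R :=
  Polynomial.resultant M.charpoly (Polynomial.derivative M.charpoly) n (n-1)

theorem cdisc_map {R S : Type*} [CommRing R] [CommRing S] (f : R →+* S) {n : ℕ}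
    (M : Matrix (Fin n) (Fin n) R) : f (cdisc M) = cdisc (M.map f) := by
  rw [cdisc, cdisc, Matrix.charpoly_map, Polynomial.derivative_map, Polynomial.resultant_map_map]

theorem cdisc_ne_zero_iff {C : Type*} [Field C] [CharZero C] {n : ℕ} (M : Matrix (Fin n) (Fin n) C) :
    cdisc M ≠ 0 ↔ M.charpoly.Separable := by
  have h1 : M.charpoly.natDegree = n := by simp [Matrix.charpoly_natDegree_eq_dim]
  have h2 : (Polynomial.derivative M.charpoly).natDegree = n - 1 := by
    rw [Polynomial.natDegree_derivative, h1]
  have := Polynomial.resultant_eq_zero_iff (f := M.charpoly) (g := Polynomial.derivative M.charpoly)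
  rw [h1, h2] at this
  rw [cdisc, Ne, this, Polynomial.Separable]
  have hm := M.charpoly_monic.ne_zero
  simp [hm]

theorem charpoly_sep_diag {C : Type*} [Field C] [IsAlgClosed C] {n : ℕ}
    (M : Matrix (Fin n) (Fin n) C) (h : M.charpoly.Separable) :
    ∃ (lam : Fin n → C) (P P' : Matrix (Fin n) (Fin n) C), Function.Injective lam ∧
      P * P' = 1 ∧ P' * P = 1 ∧ P' * M * P = Matrix.diagonal lam := by
  classical
  have hcard : M.charpoly.roots.toFinset.card = n := by
    rw [Multiset.toFinset_card_of_nodup (Polynomial.nodup_roots h),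
      (IsAlgClosed.splits M.charpoly).natDegree_eq_card_roots.symm, Matrix.charpoly_natDegree_eq_dim]
    simp
  let e := Finset.equivFinOfCardEq hcard
  let lam : Fin n → C := fun i => (e.symm i : C)
  have hinj : Function.Injective lam := Subtype.val_injective.comp e.symm.injective
  have hroot : ∀ i, M.charpoly.IsRoot (lam i) := fun i => by
    have := (e.symm i).2
    rw [Multiset.mem_toFinset] at this
    exact (Polynomial.mem_roots'.1 this).2
  have hev : ∀ i, Module.End.HasEigenvalue (Matrix.toLin' M) (lam i) := fun i => by
    rw [Module.End.hasEigenvalue_iff_isRoot_charpoly, Matrix.charpoly_toLin']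
    exact hroot i
  choose v hv using fun i => (hev i).exists_hasEigenvector
  have hli := Module.End.eigenvectors_linearIndependent' (Matrix.toLin' M) lam hinj v hv
  let P : Matrix (Fin n) (Fin n) C := Matrix.of fun i j => v j i
  have hP : IsUnit P := by
    rw [← Matrix.linearIndependent_cols_iff_isUnit]
    exact hli
  have hdet := (Matrix.isUnit_iff_isUnit_det _).1 hP
  refine ⟨lam, P, P⁻¹, hinj, Matrix.mul_nonsing_inv _ hdet, Matrix.nonsing_inv_mul _ hdet, ?_⟩
  have : M * P = P * Matrix.diagonal lam := by
    ext i j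
    have := congrFun (hv j).apply_eq_smul i
    rw [Matrix.toLin'_apply] at this
    rw [Matrix.mul_diagonal, mul_comm]
    exact this
  rw [mul_assoc, this, ← mul_assoc, Matrix.nonsing_inv_mul _ hdet, one_mul]

theorem exists_cdisc_ne_zero {C : Type*} [Field C] [CharZero C] {n : ℕ} :
    ∃ M : Matrix (Fin n) (Fin n) C, cdisc M ≠ 0 := by
  refine ⟨Matrix.diagonal fun i => (i : C), ?_⟩
  rw [cdisc_ne_zero_iff, Matrix.charpoly_diagonal]
  rw [Polynomial.separable_prod_X_sub_C_iff]
  intro i j h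
  exact Fin.ext (by simpa using h)

theorem exists_sep {k A C : Type*} [Field k] [CharZero k] [Ring A] [Algebra k A] [Field C] [Algebra k C]
    {n : ℕ} (φ : A →ₐ[k] Matrix (Fin n) (Fin n) C)
    (hφ : Submodule.span C (Set.range φ) = ⊤) : ∃ x : A, cdisc (φ x) ≠ 0 := by
  have : CharZero C := charZero_of_injective_algebraMap (algebraMap k C).injective
  obtain ⟨M, hM⟩ := exists_cdisc_ne_zero (C := C) (n := n)
  have hMs : M ∈ Submodule.span C (Set.range φ) := by rw [hφ]; trivial
  obtain ⟨c, hc⟩ := (Finsupp.mem_span_range_iff_exists_finsupp).1 hMs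
  let s := c.support
  let G : Matrix (Fin n) (Fin n) (MvPolynomial s C) :=
    ∑ i : s, (MvPolynomial.X i : MvPolynomial s C) • (φ i).map MvPolynomial.C
  have hG : ∀ v : s → C, G.map (MvPolynomial.eval v) = ∑ i : s, v i • φ i := by
    intro v
    ext p q
    simp [G, Matrix.sum_apply]
  by_contra hcon
  push Not at hcon
  have hz : cdisc G = 0 := by
    refine MvPolynomial.funext_set (fun _ : s => Set.range (algebraMap k C)) ?_
      (p := cdisc G) (q := 0) ?_
    · intro i; exact Set.infinite_range_of_injective (algebraMap k C).injective
    · intro v hv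
      choose w hw using fun i => hv i (Set.mem_univ i)
      rw [cdisc_map, hG, map_zero, ← hcon (∑ i : s, w i • (i : A))]
      congr 1
      rw [map_sum]
      refine Finset.sum_congr rfl fun i _ => ?_
      rw [map_smul, ← hw, algebraMap_smul]
  apply hM
  have := cdisc_map (MvPolynomial.eval fun i : s => c i) G
  rw [hG, hz, map_zero] at this
  rw [this, ← hc, Finsupp.sum, ← Finset.sum_coe_sort]

theorem exists_sep_line {k A C : Type*} [Field k] [CharZero k] [Ring A] [Algebra k A] [Field C] [Algebra k C]
    {n : ℕ} (φ : A →ₐ[k] Matrix (Fin n) (Fin n) C) (x g : A) (hx : cdisc (φ x) ≠ 0) :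
    ∃ t : k, t ≠ 0 ∧ cdisc (φ (x + t • g)) ≠ 0 := by
  let G : Matrix (Fin n) (Fin n) (Polynomial C) :=
    (φ x).map Polynomial.C + (Polynomial.X : Polynomial C) • (φ g).map Polynomial.C
  have hG : ∀ v : C, G.map (Polynomial.eval v) = φ x + v • φ g := by
    intro v
    ext p q
    simp [G]; exact mul_comm _ _
  have hev : ∀ v : C, (cdisc G).eval v = cdisc (φ x + v • φ g) := by
    intro v
    rw [← hG]; exact cdisc_map (Polynomial.evalRingHom v) G
  have hne : cdisc G ≠ 0 := by
    intro h; apply hx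
    have := hev 0
    simpa [h] using this.symm
  have hfin : Set.Finite ({v : C | (cdisc G).IsRoot v} ∪ {0}) :=
    (Polynomial.finite_setOfPred_isRoot hne).union (Set.finite_singleton _)
  have hinf : (Set.range (algebraMap k C)).Infinite :=
    Set.infinite_range_of_injective (algebraMap k C).injective
  obtain ⟨_, ⟨t, rfl⟩, ht⟩ := hinf.exists_notMem_finite hfin
  simp only [Set.mem_union, Set.mem_ofPred_eq, Set.mem_singleton_iff, not_or] at ht
  refine ⟨t, fun h => ht.2 (by simp [h]), ?_⟩
  have := ht.1
  rw [Polynomial.IsRoot, hev, algebraMap_smul] at this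
  simpa using this
end

section
open Matrix

theorem list_op {A : Type*} [Ring A] : ∀ (l : ℕ) (c : Fin l → A) (i0 : Fin l) (u w : A),
    ∃ a b : A, ∀ Y : A, (List.ofFn fun i => if i = i0 then u * Y * w else c i).prod = a * Y * b := by
  intro l
  induction l with
  | zero => intro c i0; exact i0.elim0
  | succ l ih =>
    intro c i0 u w
    induction i0 using Fin.cases with
    | zero =>
      refine ⟨u, w * (List.ofFn fun i : Fin l => c i.succ).prod, fun Y => ?_⟩
      simp [List.ofFn_succ, mul_assoc]
    | succ j =>
      obtain ⟨a, b, h⟩ := ih (fun i => c i.succ) j u w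
      refine ⟨c 0 * a, b, fun Y => ?_⟩
      have h0 : ¬ ((0 : Fin (l+1)) = j.succ) := (Fin.succ_ne_zero j).symm
      rw [List.ofFn_succ, List.prod_cons, if_neg h0]
      simp only [Fin.succ_inj]
      rw [h Y]; simp only [mul_assoc]

theorem formanek_op {A : Type*} [Ring A] {n : ℕ} [NeZero n] (x : A) (y : Fin n → A) :
    ∃ (ι : Type) (_ : Fintype ι) (a b : ι → A), ∀ Y : A,
      formanek x (Function.update y 0 Y) = ∑ i, a i * Y * b i := by
  have key : ∀ j : Fin n × Equiv.Perm (Fin n) × Equiv.Perm (Fin n), ∃ a b : A, ∀ Y : A,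
      ((Equiv.Perm.sign j.2.1 : ℤ) * (Equiv.Perm.sign j.2.2 : ℤ)) •
        fmon x (fun i => Function.update y 0 Y (i + j.1)) j.2.1 j.2.2 = a * Y * b := by
    rintro ⟨r, σ, τ⟩
    obtain ⟨a, b, h⟩ := list_op n (fun i => x ^ ((σ i : Fin n) : ℕ) * y (i + r) * x ^ ((τ i : Fin n) : ℕ))
      (-r) (x ^ ((σ (-r) : Fin n) : ℕ)) (x ^ ((τ (-r) : Fin n) : ℕ))
    refine ⟨((Equiv.Perm.sign σ : ℤ) * (Equiv.Perm.sign τ : ℤ)) • a, b, fun Y => ?_⟩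
    rw [smul_mul_assoc, smul_mul_assoc, ← h Y, fmon]
    congr 3
    funext i
    split_ifs with hi
    · subst hi; simp
    · have : i + r ≠ 0 := fun h => hi (eq_neg_of_add_eq_zero_left h)
      simp [this]
  choose a b h using key
  refine ⟨_, inferInstance, a, b, fun Y => ?_⟩
  simp_rw [← h, Fintype.sum_prod_type]
  rfl

theorem exists_trace_repr {C : Type*} [Field C] {n : ℕ} (s : Matrix (Fin n) (Fin n) C →ₗ[C] C) :
    ∃ B : Matrix (Fin n) (Fin n) C, ∀ M, s M = (B * M).trace := by
  refine ⟨Matrix.of fun p q => s (Matrix.single q p 1), fun M => ?_⟩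
  conv_lhs => rw [Matrix.matrix_eq_sum_single M]
  simp only [map_sum, Matrix.trace, Matrix.diag, Matrix.mul_apply, Matrix.of_apply]
  rw [Finset.sum_comm]
  refine Finset.sum_congr rfl fun i _ => Finset.sum_congr rfl fun j _ => ?_
  have : Matrix.single j i (M j i) = M j i • Matrix.single j i (1:C) := by simp
  rw [this, map_smul, smul_eq_mul, mul_comm]

theorem trace_op_diag {k A C : Type*} [Field k] [CharZero k] [Ring A] [Algebra k A] [Field C]
    [Algebra k C] {n : ℕ} [NeZero n] (φ : A →ₐ[k] Matrix (Fin n) (Fin n) C)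
    (hφ : Submodule.span C (Set.range φ) = ⊤) (x : A) (lam : Fin n → C)
    (hl : Function.Injective lam) (hx : φ x = Matrix.diagonal lam) :
    ∃ (ι : Type) (_ : Fintype ι) (a b : ι → A) (z : C), z ≠ 0 ∧
      ∀ M, ∑ i, φ (a i) * M * φ (b i) = (z * M.trace) • (1 : Matrix (Fin n) (Fin n) C) := by
  obtain ⟨κ, hκ, hform⟩ := formanek_diag lam hl
  obtain ⟨y, hy⟩ : ∃ y : Fin n → A, fmu (C := C) (fun i => φ (y i)) ≠ 0 := by
    by_contra hcon
    push Not at hcon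
    refine fmu_ne_zero (C := C) (n := n) ?_
    exact MultilinearMap.ext_of_span_eq_top (g := fun _ : Fin n => (φ : A → _)) (fun _ => hφ)
      (fun j => by simpa using hcon j)
  obtain ⟨ι, _, a, b, hab⟩ := formanek_op x y
  let s : Matrix (Fin n) (Fin n) C →ₗ[C] C := κ • fmu.toLinearMap (fun i => φ (y i)) 0
  have hs : ∀ M, s M = κ * fmu (Function.update (fun i => φ (y i)) 0 M) := fun M => rfl
  have hL : ∀ M, ∑ i, φ (a i) * M * φ (b i) = s M • (1 : Matrix (Fin n) (Fin n) C) := by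
    intro M
    have hM : M ∈ Submodule.span C (Set.range φ) := by rw [hφ]; trivial
    induction hM using Submodule.span_induction with
    | mem M h =>
      obtain ⟨Y, rfl⟩ := h
      have := congrArg φ (hab Y)
      have h2 := formanek_map (φ : A →+* Matrix (Fin n) (Fin n) C) x (Function.update y 0 Y)
      simp only [RingHom.coe_coe] at h2
      rw [h2, hx, hform] at this
      rw [hs]
      have h3 : (fun i => φ (Function.update y 0 Y i)) = Function.update (fun i => φ (y i)) 0 (φ Y) := by
        funext i
        by_cases h : i = 0
        · subst h; simp
        · simp [h]
      rw [h3] at this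
      rw [this]; simp
    | zero => simp
    | add M N _ _ hM hN => simp [mul_add, add_mul, Finset.sum_add_distrib, hM, hN, add_smul]
    | smul c M _ hM => simp [← Finset.smul_sum, hM, mul_smul]
  obtain ⟨B, hB⟩ := exists_trace_repr s
  have hB0 : B ≠ 0 := by
    intro h
    have h1 : s (φ (y 0)) ≠ 0 := by
      rw [hs]
      have : Function.update (fun i => φ (y i)) 0 (φ (y 0)) = fun i => φ (y i) := by
        simp
      rw [this]; exact mul_ne_zero hκ hy
    apply h1; rw [hB, h]; simp
  obtain ⟨u, v, huv⟩ : ∃ u v : A, (B * (φ u * B * φ v)).trace ≠ 0 := by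
    by_contra hcon
    push Not at hcon
    have h1 : ∀ (v : A) (U : Matrix (Fin n) (Fin n) C), (B * (U * B * φ v)).trace = 0 := by
      intro v U
      have hM : U ∈ Submodule.span C (Set.range φ) := by rw [hφ]; trivial
      induction hM using Submodule.span_induction with
      | mem M h => obtain ⟨Y, rfl⟩ := h; exact hcon Y v
      | zero => simp
      | add M N _ _ hM hN => simp [mul_add, add_mul, hM, hN]
      | smul c M _ hM => simp [hM]
    have h2 : ∀ (U V : Matrix (Fin n) (Fin n) C), (B * (U * B * V)).trace = 0 := by
      intro U V
      have hM : V ∈ Submodule.span C (Set.range φ) := by rw [hφ]; trivial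
      induction hM using Submodule.span_induction with
      | mem M h => obtain ⟨Y, rfl⟩ := h; exact h1 Y U
      | zero => simp
      | add M N _ _ hM hN => simp [mul_add, hM, hN]
      | smul c M _ hM => simp [hM]
    apply hB0
    ext p q
    have := h2 (Matrix.single q p 1) (Matrix.single q p 1)
    rw [← mul_assoc, Matrix.trace_mul_comm, Matrix.trace_single_mul, ← mul_assoc,
      ] at this
    simpa [Matrix.mul_apply, Matrix.single_apply, Finset.sum_ite_eq, ite_and] using this
  refine ⟨ι × ι, inferInstance, fun ij => a ij.1 * (v * b ij.2), fun ij => (a ij.2 * u) * b ij.1,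
    (B * (φ u * B * φ v)).trace, huv, fun M => ?_⟩
  rw [Fintype.sum_prod_type, Finset.sum_comm]
  have : ∀ j, ∑ i, φ (a i * (v * b j)) * M * φ ((a j * u) * b i) =
      (((φ (a j) * (φ u * B * φ v) * φ (b j)) * M).trace) • (1 : Matrix (Fin n) (Fin n) C) := by
    intro j
    have := hL (φ v * φ (b j) * M * φ (a j) * φ u)
    rw [hB] at this
    have h2 : (φ (a j) * (φ u * B * φ v) * φ (b j) * M).trace =
       (B * (φ v * φ (b j) * M * φ (a j) * φ u)).trace := by
      calc _ = ((φ (a j) * φ u) * (B * (φ v * φ (b j) * M))).trace := by simp only [mul_assoc]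
        _ = _ := by rw [Matrix.trace_mul_comm]; simp only [mul_assoc]
    rw [h2, ← this]
    simp [mul_assoc]
  simp only [this]
  rw [← Finset.sum_smul, ← Matrix.trace_sum, ← Finset.sum_mul, hL, hB]
  simp

theorem trace_op {k A C : Type*} [Field k] [CharZero k] [Ring A] [Algebra k A] [Field C] [IsAlgClosed C]
    [Algebra k C] {n : ℕ} [NeZero n] (φ : A →ₐ[k] Matrix (Fin n) (Fin n) C)
    (hφ : Submodule.span C (Set.range φ) = ⊤) :
    ∃ (ι : Type) (_ : Fintype ι) (a b : ι → A) (z : C), z ≠ 0 ∧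
      ∀ M, ∑ i, φ (a i) * M * φ (b i) = (z * M.trace) • (1 : Matrix (Fin n) (Fin n) C) := by
  have : CharZero C := charZero_of_injective_algebraMap (algebraMap k C).injective
  obtain ⟨x, hx⟩ := exists_sep φ hφ
  obtain ⟨lam, P, P', hl, h1, h2, hd⟩ := charpoly_sep_diag (φ x) ((cdisc_ne_zero_iff _).1 hx)
  let cj : Matrix (Fin n) (Fin n) C →ₐ[C] Matrix (Fin n) (Fin n) C :=
    AlgHom.ofLinearMap ((LinearMap.mulLeft C P').comp (LinearMap.mulRight C P)) (by simp [h2])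
      (fun M N => by
        simp only [LinearMap.comp_apply, LinearMap.mulLeft_apply, LinearMap.mulRight_apply]
        calc _ = P' * M * 1 * N * P := by simp only [mul_assoc, one_mul]
          _ = _ := by rw [← h1]; simp only [mul_assoc])
  have hcj : ∀ M, cj M = P' * M * P := fun M => by simp [cj, mul_assoc]
  let φ' : A →ₐ[k] Matrix (Fin n) (Fin n) C := (cj.restrictScalars k).comp φ
  have hφ' : ∀ g, φ' g = P' * φ g * P := fun g => hcj _
  have hspan : Submodule.span C (Set.range φ') = ⊤ := by
    have : Set.range φ' = cj.toLinearMap '' (Set.range φ) := by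
      rw [← Set.range_comp]; rfl
    rw [this, Submodule.span_image, hφ, Submodule.map_top, LinearMap.range_eq_top]
    intro M
    refine ⟨P * M * P', ?_⟩
    change cj _ = M
    rw [hcj]
    calc _ = (P' * P) * M * (P' * P) := by simp only [mul_assoc]
      _ = M := by simp [h2]
  obtain ⟨ι, _, a, b, z, hz, h⟩ := trace_op_diag φ' hspan x lam hl (by rw [hφ', hd])
  refine ⟨ι, inferInstance, a, b, z, hz, fun M => ?_⟩
  have := h (P' * M * P)
  have h3 : ∀ i, φ' (a i) * (P' * M * P) * φ' (b i) = P' * (φ (a i) * M * φ (b i)) * P := by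
    intro i
    rw [hφ', hφ']
    calc _ = P' * φ (a i) * (P * P') * M * (P * P') * φ (b i) * P := by simp only [mul_assoc]
      _ = _ := by simp only [h1, mul_one, mul_assoc]
  simp only [h3] at this
  rw [← Finset.sum_mul, ← Finset.mul_sum] at this
  calc _ = (P * P') * (∑ i, φ (a i) * M * φ (b i)) * (P * P') := by simp [h1]
    _ = P * (P' * (∑ i, φ (a i) * M * φ (b i)) * P) * P' := by simp only [mul_assoc]
    _ = _ := by
      rw [this, Matrix.trace_mul_comm, ← mul_assoc, h1]
      simp [h1]
end

section
open Matrix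

theorem scalar_of_commute {A C : Type*} [Field C] {n : ℕ} (φ : A → Matrix (Fin n) (Fin n) C)
    (hφ : Submodule.span C (Set.range φ) = ⊤) (M : Matrix (Fin n) (Fin n) C)
    (h : ∀ r, M * φ r = φ r * M) :
    ∃ c : C, M = algebraMap C _ c := by
  have hc : ∀ N, Commute N M := by
    intro N
    have hN : N ∈ Submodule.span C (Set.range φ) := by rw [hφ]; trivial
    induction hN using Submodule.span_induction with
    | mem N h' => obtain ⟨r, rfl⟩ := h'; exact (h r).symm
    | zero => exact Commute.zero_left _
    | add N N' _ _ h1 h2 => exact h1.add_left h2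
    | smul c N _ h1 => exact h1.smul_left c
  obtain ⟨c, hc⟩ := Matrix.mem_range_scalar_iff_commute_single'.2 (fun i j => hc _)
  exact ⟨c, hc.symm⟩

/-- central scalars in the image of `φ` -/
def repZ {k A C : Type} [Field k] [Ring A] [Algebra k A] [Field C] [Algebra k C] {n : ℕ}
    (φ : A →ₐ[k] Matrix (Fin n) (Fin n) C) : Subring C :=
  (φ.range.toSubring).comap (algebraMap C (Matrix (Fin n) (Fin n) C))

theorem mem_repZ {k A C : Type} [Field k] [Ring A] [Algebra k A] [Field C] [Algebra k C] {n : ℕ}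
    (φ : A →ₐ[k] Matrix (Fin n) (Fin n) C) (c : C) :
    c ∈ repZ φ ↔ ∃ a, φ a = algebraMap C _ c := Iff.rfl

def repF {k A C : Type} [Field k] [Ring A] [Algebra k A] [Field C] [Algebra k C] {n : ℕ}
    (φ : A →ₐ[k] Matrix (Fin n) (Fin n) C) : Subfield C := Subfield.closure (repZ φ : Set C)

theorem mem_repF {k A C : Type} [Field k] [Ring A] [Algebra k A] [Field C] [Algebra k C] {n : ℕ}
    (φ : A →ₐ[k] Matrix (Fin n) (Fin n) C) (c : C) :
    c ∈ repF φ ↔ ∃ y ∈ repZ φ, ∃ z ∈ repZ φ, z ≠ 0 ∧ z * c = y := by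
  rw [repF, Subfield.mem_closure_iff, Subring.closure_eq]
  constructor
  · rintro ⟨y, hy, z, hz, rfl⟩
    by_cases h : z = 0
    · exact ⟨0, zero_mem _, 1, one_mem _, one_ne_zero, by simp [h]⟩
    · exact ⟨y, hy, z, hz, h, by field_simp⟩
  · rintro ⟨y, hy, z, hz, h, h'⟩
    exact ⟨y, hy, z, hz, by rw [← h']; field_simp⟩

theorem repZ_smul {k A C : Type} [Field k] [Ring A] [Algebra k A] [Field C] [Algebra k C] {n : ℕ}
    (φ : A →ₐ[k] Matrix (Fin n) (Fin n) C) {c : C} (hc : c ∈ repZ φ) {M} (hM : M ∈ φ.range) :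
    c • M ∈ φ.range := by
  rw [Algebra.smul_def]
  exact mul_mem hc hM

def repQ {k A C : Type} [Field k] [Ring A] [Algebra k A] [Field C] [Algebra k C] {n : ℕ}
    (φ : A →ₐ[k] Matrix (Fin n) (Fin n) C) : Subalgebra (repF φ) (Matrix (Fin n) (Fin n) C) where
  carrier := {M | ∃ w ∈ repZ φ, w ≠ 0 ∧ w • M ∈ φ.range}
  mul_mem' := by
    rintro M N ⟨w, hw, h, h'⟩ ⟨v, hv, g, g'⟩
    refine ⟨w * v, mul_mem hw hv, mul_ne_zero h g, ?_⟩
    have := mul_mem h' g'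
    rwa [smul_mul_smul_comm] at this
  add_mem' := by
    rintro M N ⟨w, hw, h, h'⟩ ⟨v, hv, g, g'⟩
    refine ⟨w * v, mul_mem hw hv, mul_ne_zero h g, ?_⟩
    have := add_mem (repZ_smul φ hv h') (repZ_smul φ hw g')
    rw [smul_smul, smul_smul, mul_comm v w] at this
    rwa [smul_add]
  algebraMap_mem' := by
    rintro ⟨x, hx⟩
    obtain ⟨y, hy, z, hz, h, h'⟩ := (mem_repF φ x).1 hx
    refine ⟨z, hz, h, ?_⟩
    have : z • (algebraMap (repF φ) (Matrix (Fin n) (Fin n) C)) ⟨x, hx⟩ = algebraMap C _ y := by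
      rw [← h', IsScalarTower.algebraMap_apply (repF φ) C, Algebra.smul_def, map_mul]
      rfl
    rw [this]
    exact hy

theorem mem_repQ {k A C : Type} [Field k] [Ring A] [Algebra k A] [Field C] [Algebra k C] {n : ℕ}
    (φ : A →ₐ[k] Matrix (Fin n) (Fin n) C) (M) :
    M ∈ repQ φ ↔ ∃ w ∈ repZ φ, w ≠ 0 ∧ w • M ∈ φ.range := Iff.rfl

theorem range_le_repQ {k A C : Type} [Field k] [Ring A] [Algebra k A] [Field C] [Algebra k C] {n : ℕ}
    (φ : A →ₐ[k] Matrix (Fin n) (Fin n) C) (a : A) : φ a ∈ repQ φ :=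
  ⟨1, one_mem _, one_ne_zero, by simp⟩

theorem trace_mem_repF {k A C : Type} [Field k] [CharZero k] [Ring A] [Algebra k A] [Field C] [IsAlgClosed C]
    [Algebra k C] {n : ℕ} [NeZero n] (φ : A →ₐ[k] Matrix (Fin n) (Fin n) C)
    (hφ : Submodule.span C (Set.range φ) = ⊤) {M} (hM : M ∈ repQ φ) : M.trace ∈ repF φ := by
  have : CharZero C := charZero_of_injective_algebraMap (algebraMap k C).injective
  obtain ⟨ι, _, a, b, z, hz, h⟩ := trace_op φ hφ
  have key : ∀ r ∈ φ.range, z * r.trace ∈ repZ φ := by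
    rintro _ ⟨r, rfl⟩
    refine ⟨∑ i, a i * r * b i, ?_⟩
    have := h (φ r)
    simp only [← map_mul, ← map_sum] at this
    rw [Algebra.algebraMap_eq_smul_one]
    exact this
  obtain ⟨w, hw, h0, h'⟩ := hM
  rw [mem_repF]
  refine ⟨n * (z * (w • M).trace), mul_mem (natCast_mem _ _) (key _ h'), w * (z * (1 : Matrix (Fin n) (Fin n) C).trace),
    mul_mem hw (key _ (one_mem _)), ?_, ?_⟩
  · simp [hz, h0, NeZero.ne n]
  · simp; ring

theorem center_repQ {k A C : Type} [Field k] [Ring A] [Algebra k A] [Field C] [Algebra k C] {n : ℕ}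
    [NeZero n] (φ : A →ₐ[k] Matrix (Fin n) (Fin n) C)
    (hφ : Submodule.span C (Set.range φ) = ⊤) :
    (algebraMap (repF φ) (repQ φ)).range = Subring.center (repQ φ) := by
  ext ⟨x, hx⟩
  constructor
  · rintro ⟨c, hc⟩
    rw [← hc, Subring.mem_center_iff]
    intro g
    exact (Algebra.commutes c g).symm
  · intro h
    rw [Subring.mem_center_iff] at h
    obtain ⟨c, rfl⟩ := scalar_of_commute φ hφ x (fun r => (congrArg Subtype.val (h ⟨φ r, range_le_repQ φ r⟩)).symm)
    have hc : c ∈ repF φ := by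
      obtain ⟨w, hw, h0, h'⟩ := hx
      rw [mem_repF]
      refine ⟨w * c, ?_, w, hw, h0, rfl⟩
      rw [Algebra.smul_def, ← map_mul] at h'
      exact h'
    refine ⟨⟨c, hc⟩, ?_⟩
    apply Subtype.ext
    rfl

theorem exists_trace_mul_ne {A C : Type*} [Field C] {n : ℕ} (φ : A → Matrix (Fin n) (Fin n) C)
    (hφ : Submodule.span C (Set.range φ) = ⊤) (M : Matrix (Fin n) (Fin n) C)
    (h : M ≠ 0) : ∃ r, (φ r * M).trace ≠ 0 := by
  by_contra hcon
  push Not at hcon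
  have hc : ∀ N, (N * M).trace = 0 := by
    intro N
    have hN : N ∈ Submodule.span C (Set.range φ) := by rw [hφ]; trivial
    induction hN using Submodule.span_induction with
    | mem N h' => obtain ⟨r, rfl⟩ := h'; exact hcon r
    | zero => simp
    | add N N' _ _ h1 h2 => simp [add_mul, h1, h2]
    | smul c N _ h1 => simp [h1]
  apply h
  ext i j
  have := hc (Matrix.single j i 1)
  rw [Matrix.trace_single_mul] at this
  simpa using this

theorem finrank_repQ {k A C : Type} [Field k] [CharZero k] [Ring A] [Algebra k A] [Field C] [IsAlgClosed C]
    [Algebra k C] {n : ℕ} [NeZero n] (φ : A →ₐ[k] Matrix (Fin n) (Fin n) C)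
    (hφ : Submodule.span C (Set.range φ) = ⊤) : Module.finrank (repF φ) (repQ φ) = n ^ 2 := by
  obtain ⟨κ, a, ha, hs, hli⟩ := exists_linearIndependent' (K := C) (φ : A → _)
  rw [hφ] at hs
  let B := Module.Basis.mk hli hs.ge
  haveI : Fintype κ := FiniteDimensional.fintypeBasisIndex B
  have hcard : Fintype.card κ = n ^ 2 := by
    rw [← Module.finrank_eq_card_basis B, Module.finrank_matrix]; simp [sq]
  let L : repQ φ →ₗ[repF φ] (κ → repF φ) :=
    { toFun := fun q j => ⟨(φ (a j) * q).trace, trace_mem_repF φ hφ (mul_mem (range_le_repQ φ _) q.2)⟩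
      map_add' := fun x y => by ext j; simp [mul_add]
      map_smul' := fun c x => by
        ext j
        simp [Subfield.smul_def] }
  have hL : Function.Injective L := by
    rw [injective_iff_map_eq_zero]
    intro q hq
    by_contra h0
    obtain ⟨r, hr⟩ := exists_trace_mul_ne (φ ∘ a) hs q.1 (fun h => h0 (Subtype.ext h))
    exact hr (congrArg Subtype.val (congrFun hq r))
  haveI : Module.Finite (repF φ) (repQ φ) := Module.Finite.of_injective L hL
  apply le_antisymm
  · have := LinearMap.finrank_le_finrank_of_injective hL
    rwa [Module.finrank_fintype_fun_eq_card, hcard] at this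
  · rw [← hcard]
    have h1 : LinearIndependent (repF φ) (φ ∘ a) := hli.restrict_scalars (by
      intro x y hxy
      simpa [Subfield.smul_def] using hxy)
    have h2 : LinearIndependent (repF φ) (fun j : κ => (⟨φ (a j), range_le_repQ φ _⟩ : repQ φ)) :=
      LinearIndependent.of_comp (repQ φ).val.toLinearMap h1
    exact h2.fintype_card_le_finrank

theorem simple_repQ {k A C : Type} [Field k] [CharZero k] [Ring A] [Algebra k A] [Field C] [IsAlgClosed C]
    [Algebra k C] {n : ℕ} [NeZero n] (φ : A →ₐ[k] Matrix (Fin n) (Fin n) C)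
    (hφ : Submodule.span C (Set.range φ) = ⊤) : IsSimpleRing (repQ φ) := by
  apply IsSimpleRing.of_eq_bot_or_eq_top
  intro I
  by_cases hI : I = ⊥
  · exact Or.inl hI
  right
  obtain ⟨q, hq, hq0⟩ : ∃ q ∈ I, q ≠ 0 := by
    by_contra hcon
    push Not at hcon
    apply hI
    rw [eq_bot_iff, TwoSidedIdeal.le_iff]
    intro x hx
    have := hcon x hx
    subst this
    exact zero_mem _
  obtain ⟨r, hr⟩ := exists_trace_mul_ne φ hφ q.1 (fun h => hq0 (Subtype.ext h))
  obtain ⟨ι, _, a, b, z, hz, h⟩ := trace_op φ hφ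
  have h1 := h (φ r * q.1)
  set s := z * (φ r * q.1).trace with hs
  have hs0 : s ≠ 0 := mul_ne_zero hz hr
  let f : A → repQ φ := fun a => ⟨φ a, range_le_repQ φ a⟩
  have h2 : ∑ i, f (a i) * (f r * q) * f (b i) ∈ I := by
    refine sum_mem fun i _ => ?_
    exact I.mul_mem_right _ _ (I.mul_mem_left _ _ (I.mul_mem_left _ _ hq))
  have h3 : ((∑ i, f (a i) * (f r * q) * f (b i) : repQ φ) : Matrix (Fin n) (Fin n) C) = s • 1 := by
    rw [← h1]; simp [f]
  have h4 : s ∈ repF φ := by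
    have := trace_mem_repF φ hφ (∑ i, f (a i) * (f r * q) * f (b i)).2
    rw [h3, Matrix.trace_smul, Matrix.trace_one, Fintype.card_fin, smul_eq_mul] at this
    have : CharZero C := charZero_of_injective_algebraMap (algebraMap k C).injective
    have hn : (n : C) ≠ 0 := by exact_mod_cast NeZero.ne n
    have e : s = s * n / n := by field_simp
    rw [e]
    exact div_mem ‹_› (natCast_mem _ _)
  have h5 : (∑ i, f (a i) * (f r * q) * f (b i)) * algebraMap (repF φ) (repQ φ) ⟨s, h4⟩⁻¹ = 1 := by
    apply Subtype.ext
    change ((∑ i, f (a i) * (f r * q) * f (b i) : repQ φ) : Matrix (Fin n) (Fin n) C) * algebraMap C _ s⁻¹ = 1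
    rw [h3, ← Algebra.algebraMap_eq_smul_one, ← map_mul, mul_inv_cancel₀ hs0, map_one]
  rw [← TwoSidedIdeal.one_mem_iff, ← h5]
  exact I.mul_mem_right _ _ h2

theorem rep_specN {k A C : Type} [Field k] [CharZero k] [Ring A] [Algebra k A] [Field C] [IsAlgClosed C]
    [Algebra k C] {n : ℕ} [NeZero n] (φ : A →ₐ[k] Matrix (Fin n) (Fin n) C)
    (hφ : Submodule.span C (Set.range φ) = ⊤) (J : TwoSidedIdeal A) (hJ : ∀ p, φ p = 0 ↔ p ∈ J) :
    J ∈ SpecN n A := by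
  have hmk0 : ∀ a : A, (J.ringCon.mk' a = 0) ↔ φ a = 0 := by
    intro a
    rw [hJ, TwoSidedIdeal.mem_iff, ← RingCon.eq]; rfl
  have hsurj : Function.Surjective J.ringCon.mk' := J.ringCon.mk'_surjective
  constructor
  · refine ⟨⟨⟨1, 0, ?_⟩⟩, ?_⟩
    · intro h
      have := (hmk0 1).1 (by simpa using h)
      simp at this
    · intro a b h
      obtain ⟨a, rfl⟩ := hsurj a
      obtain ⟨b, rfl⟩ := hsurj b
      rw [hmk0, hmk0]
      by_contra hcon
      push Not at hcon
      obtain ⟨h1, h2⟩ := hcon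
      obtain ⟨r, hr⟩ := exists_trace_mul_ne φ hφ _ h1
      obtain ⟨s, hs⟩ := exists_trace_mul_ne φ hφ _ h2
      obtain ⟨ι, _, c, d, z, hz, ht⟩ := trace_op φ hφ
      have h3 := ht (φ r * φ a)
      have h4 : ∀ x, φ a * φ x * φ b = 0 := by
        intro x
        rw [← map_mul, ← map_mul, ← hmk0]
        simpa using h (J.ringCon.mk' x)
      have h5 := congrArg (fun M => M * φ b) h3
      simp only [Finset.sum_mul] at h5
      have h6 : ∀ i, φ (c i) * (φ r * φ a) * φ (d i) * φ b = 0 := by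
        intro i
        calc _ = φ (c i) * φ r * (φ a * φ (d i) * φ b) := by simp only [mul_assoc]
          _ = 0 := by rw [h4, mul_zero]
      simp only [h6, Finset.sum_const_zero, smul_mul_assoc, one_mul] at h5
      have := (smul_eq_zero.1 h5.symm)
      rcases this with h | h
      · exact (mul_ne_zero hz hr) h
      · exact h2 h
  · let g : A →+* repQ φ := (φ : A →+* Matrix (Fin n) (Fin n) C).codRestrict (repQ φ) (range_le_repQ φ)
    have hg : ∀ a, ((g a : repQ φ) : Matrix (Fin n) (Fin n) C) = φ a := fun a => rfl
    let f : idealQuot J →+* repQ φ := J.ringCon.lift g (by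
      intro x y hxy
      rw [TwoSidedIdeal.rel_iff, ← hJ, map_sub, sub_eq_zero] at hxy
      exact Subtype.ext hxy)
    have hf : ∀ a, f (J.ringCon.mk' a) = g a := fun a => rfl
    have hinj : Function.Injective f := by
      rw [injective_iff_map_eq_zero]
      intro x hx
      obtain ⟨a, rfl⟩ := hsurj x
      rw [hmk0, ← hg, ← hf, hx]; rfl
    refine ⟨repQ φ, inferInstance, f, hinj, ?_, ?_, simple_repQ φ hφ, repF φ, inferInstance,
      inferInstance, center_repQ φ hφ, finrank_repQ φ hφ⟩
    · intro c hc hc0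
      obtain ⟨c, rfl⟩ := hsurj c
      rw [Subring.mem_center_iff] at hc
      obtain ⟨s, hs⟩ := scalar_of_commute φ hφ (φ c) (fun r => by
        have := congrArg (fun x => ((f x : repQ φ) : Matrix (Fin n) (Fin n) C)) (hc (J.ringCon.mk' r))
        simp only [map_mul, hf] at this
        exact this.symm)
      have hs0 : s ≠ 0 := by
        rintro rfl
        rw [map_zero, ← hmk0] at hs
        exact hc0 hs
      have hsF : s ∈ repF φ := Subfield.subset_closure ⟨c, hs⟩
      have : f (J.ringCon.mk' c) = algebraMap (repF φ) (repQ φ) ⟨s, hsF⟩ := Subtype.ext hs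
      rw [this]
      exact (IsUnit.mk0 (⟨s, hsF⟩ : repF φ) (fun h => hs0 (congrArg Subtype.val h))).map _
    · rintro ⟨q, w, ⟨c, hc⟩, h0, ⟨r, hr⟩⟩
      refine ⟨J.ringCon.mk' r, J.ringCon.mk' c, ?_, ?_, ?_⟩
      · rw [Subring.mem_center_iff]
        intro x
        obtain ⟨x, rfl⟩ := hsurj x
        apply hinj
        rw [map_mul, map_mul]
        apply Subtype.ext
        change φ x * φ c = φ c * φ x
        have hc : φ c = algebraMap C _ w := hc
        rw [hc]
        exact (Algebra.commutes w _).symm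
      · rw [Ne, hmk0]
        have hc : φ c = algebraMap C _ w := hc
        rw [hc]
        intro h
        exact h0 ((FaithfulSMul.algebraMap_eq_zero_iff _ _).1 h)
      · apply Subtype.ext
        change q * φ c = φ r
        have hc : φ c = algebraMap C _ w := hc
        have hr : φ r = w • q := hr
        rw [hc, hr, Algebra.smul_def, Algebra.commutes]
end

section
open Matrix
open scoped TensorProduct

/-- multiplication algebra -/
def multAlg (K Q : Type) [Field K] [Ring Q] [Algebra K Q] : Subalgebra K (Module.End K Q) :=
  Algebra.adjoin K (Set.range (LinearMap.mulLeft K (A := Q)) ∪ Set.range (LinearMap.mulRight K (A := Q)))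

theorem mulLeft_mem_multAlg {K Q : Type} [Field K] [Ring Q] [Algebra K Q] (a : Q) :
    LinearMap.mulLeft K a ∈ multAlg K Q := Algebra.subset_adjoin (Or.inl ⟨a, rfl⟩)

theorem mulRight_mem_multAlg {K Q : Type} [Field K] [Ring Q] [Algebra K Q] (a : Q) :
    LinearMap.mulRight K a ∈ multAlg K Q := Algebra.subset_adjoin (Or.inr ⟨a, rfl⟩)

theorem multAlg_simple (K Q : Type) [Field K] [Ring Q] [Algebra K Q] [IsSimpleRing Q] :
    IsSimpleModule (multAlg K Q) Q := by
  rw [isSimpleModule_iff]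
  refine { exists_pair_ne := ⟨⊥, ⊤, bot_ne_top⟩, eq_bot_or_eq_top := fun N => ?_ }
  have hl : ∀ a x : Q, x ∈ N → a * x ∈ N := fun a x hx =>
    N.smul_mem (⟨_, mulLeft_mem_multAlg a⟩ : multAlg K Q) hx
  have hr : ∀ a x : Q, x ∈ N → x * a ∈ N := fun a x hx =>
    N.smul_mem (⟨_, mulRight_mem_multAlg a⟩ : multAlg K Q) hx
  let I : TwoSidedIdeal Q := TwoSidedIdeal.mk' (N : Set Q) N.zero_mem (fun h h' => N.add_mem h h')
    (fun {x} h => by simpa using hl (-1) x h) (fun {x y} h => hl x y h) (fun {x y} h => hr y x h)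
  have hI : ∀ x, x ∈ I ↔ x ∈ N := fun x => TwoSidedIdeal.mem_mk' _ _ _ _ _ _ _
  rcases eq_bot_or_eq_top I with h | h
  · left
    rw [eq_bot_iff]
    intro x hx
    rw [← hI, h] at hx
    exact hx
  · right
    rw [eq_top_iff]
    intro x _
    rw [← hI, h]
    trivial

theorem mem_multAlg (K Q : Type) [Field K] [Ring Q] [Algebra K Q] [IsSimpleRing Q]
    [FiniteDimensional K Q] (hc : (algebraMap K Q).range = Subring.center Q) (g : Module.End K Q) :
    g ∈ multAlg K Q := by
  have := multAlg_simple K Q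
  have key : ∀ e : Module.End (multAlg K Q) Q, ∃ c : K, ∀ q, e q = c • q := by
    intro e
    have h1 : ∀ q, e q = q * e 1 := fun q => by
      have := e.map_smul (⟨_, mulLeft_mem_multAlg q⟩ : multAlg K Q) 1
      change e (q * 1) = q * e 1 at this
      rwa [mul_one] at this
    have h2 : ∀ q, e q = e 1 * q := fun q => by
      have := e.map_smul (⟨_, mulRight_mem_multAlg q⟩ : multAlg K Q) 1
      change e (1 * q) = e 1 * q at this
      rwa [one_mul] at this
    have h3 : e 1 ∈ (algebraMap K Q).range := by
      rw [hc, Subring.mem_center_iff]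
      intro q; rw [← h1, h2]
    obtain ⟨c, hc⟩ := h3
    exact ⟨c, fun q => by rw [h2, ← hc, Algebra.smul_def]⟩
  let f : Module.End (Module.End (multAlg K Q) Q) Q :=
    { toFun := g
      map_add' := g.map_add
      map_smul' := fun e q => by
        obtain ⟨c, hc⟩ := key e
        change g (e q) = e (g q)
        rw [hc, hc, map_smul] }
  classical
  let b := Module.finBasis K Q
  obtain ⟨r, hr⟩ := jacobson_density (R := multAlg K Q) f (Finset.univ.image b)
  have : g = r.1 := by
    refine b.ext fun i => ?_
    exact hr (b i) (by simp)
  rw [this]; exact r.2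

theorem tensor_simple (K Q C : Type) [Field K] [Ring Q] [Algebra K Q] [IsSimpleRing Q]
    [FiniteDimensional K Q] (hc : (algebraMap K Q).range = Subring.center Q)
    [Field C] [Algebra K C] : IsSimpleRing (C ⊗[K] Q) := by
  let b := Module.finBasis K Q
  let B := Algebra.TensorProduct.basis C b
  have hne : Nontrivial (C ⊗[K] Q) := inferInstance
  apply IsSimpleRing.of_eq_bot_or_eq_top
  intro I
  by_cases hI : I = ⊥
  · exact Or.inl hI
  right
  obtain ⟨w, hw, hw0⟩ : ∃ q ∈ I, q ≠ 0 := by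
    by_contra hcon
    push Not at hcon
    apply hI
    rw [eq_bot_iff, TwoSidedIdeal.le_iff]
    intro x hx
    have := hcon x hx
    subst this
    exact zero_mem _
  have hop : ∀ T ∈ multAlg K Q, ∀ x ∈ I, (T.baseChange C) x ∈ I := by
    intro T hT
    induction hT using Algebra.adjoin_induction with
    | mem T h =>
      intro x hx
      rcases h with ⟨a, rfl⟩ | ⟨a, rfl⟩
      · have : (LinearMap.mulLeft K a).baseChange C x = (1 ⊗ₜ a) * x := by
          clear hx
          induction x using TensorProduct.induction_on with
          | zero => simp
          | tmul c q => simp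
          | add x y h1 h2 => rw [map_add, h1, h2, mul_add]
        rw [this]; exact I.mul_mem_left _ _ hx
      · have : (LinearMap.mulRight K a).baseChange C x = x * (1 ⊗ₜ a) := by
          clear hx
          induction x using TensorProduct.induction_on with
          | zero => simp
          | tmul c q => simp
          | add x y h1 h2 => rw [map_add, h1, h2, add_mul]
        rw [this]; exact I.mul_mem_right _ _ hx
    | algebraMap c =>
      intro x hx
      have : (algebraMap K (Module.End K Q) c).baseChange C x = (algebraMap K C c ⊗ₜ 1) * x := by
        clear hx
        induction x using TensorProduct.induction_on with
        | zero => simp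
        | tmul d q =>
          rw [LinearMap.baseChange_tmul, Module.algebraMap_end_apply, Algebra.TensorProduct.tmul_mul_tmul,
            one_mul, TensorProduct.tmul_smul, TensorProduct.smul_tmul', Algebra.smul_def]
        | add x y h1 h2 => rw [map_add, h1, h2, mul_add]
      rw [this]; exact I.mul_mem_left _ _ hx
    | add S T _ _ hS hT =>
      intro x hx
      rw [LinearMap.baseChange_add]
      exact add_mem (hS x hx) (hT x hx)
    | mul S T _ _ hS hT =>
      intro x hx
      rw [LinearMap.baseChange_mul]
      exact hS _ (hT x hx)
  obtain ⟨i, hi⟩ : ∃ i, B.repr w i ≠ 0 := by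
    by_contra hcon
    push Not at hcon
    apply hw0
    apply B.repr.injective
    ext i; simp [hcon]
  have h1 := hop ((b.coord i).smulRight 1) (mem_multAlg K Q hc _) w hw
  have h2 : ((b.coord i).smulRight (1 : Q)).baseChange C = (B.coord i).smulRight (1 : C ⊗[K] Q) := by
    refine B.ext fun j => ?_
    rw [LinearMap.smulRight_apply, Module.Basis.coord_apply, Module.Basis.repr_self,
      Algebra.TensorProduct.basis_apply, LinearMap.baseChange_tmul, LinearMap.smulRight_apply,
      Module.Basis.coord_apply, Module.Basis.repr_self]
    by_cases h : j = i
    · subst h; simp [Algebra.TensorProduct.one_def]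
    · simp [h]
  rw [h2] at h1
  rw [← TwoSidedIdeal.one_mem_iff]
  have h3 : (algebraMap C (C ⊗[K] Q) (B.repr w i)⁻¹) * ((B.coord i).smulRight (1 : C ⊗[K] Q)) w = 1 := by
    rw [LinearMap.smulRight_apply, ← Algebra.smul_def, smul_smul, Module.Basis.coord_apply, inv_mul_cancel₀ hi, one_smul]
  rw [← h3]
  exact I.mul_mem_left _ _ h1

theorem specN_rep {k A : Type} [Field k] [Ring A] [Algebra k A] {n : ℕ} (hn : 1 ≤ n)
    (J : TwoSidedIdeal A) (hJ : J ∈ SpecN n A) :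
    ∃ (C : Type) (_ : Field C) (_ : IsAlgClosed C) (_ : Algebra k C)
      (φ : A →ₐ[k] Matrix (Fin n) (Fin n) C), (∀ p, φ p = 0 ↔ p ∈ J) ∧
      Submodule.span C (Set.range φ) = ⊤ := by
  obtain ⟨-, Q, _, f, hinj, hunit, hfrac, hsimple, K, _, _, hcenter, hfin⟩ := hJ
  have hfd : FiniteDimensional K Q := by
    apply Module.finite_of_finrank_pos
    rw [hfin]; positivity
  let F : A →+* Q := f.comp J.ringCon.mk'
  have hF0 : ∀ p, F p = 0 ↔ p ∈ J := by
    intro p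
    change f (J.ringCon.mk' p) = 0 ↔ _
    rw [map_eq_zero_iff f hinj, TwoSidedIdeal.mem_iff, ← RingCon.eq]; rfl
  have hcent : ∀ x : Q, (∀ r, x * f r = f r * x) → x ∈ Subring.center Q := by
    intro x hx
    rw [Subring.mem_center_iff]
    intro q
    obtain ⟨r, c, hc, hc0, h⟩ := hfrac q
    apply (hunit c hc hc0).mul_right_cancel
    calc q * x * f c = q * f c * x := by rw [mul_assoc, hx, mul_assoc]
      _ = x * f r := by rw [h, hx]
      _ = x * q * f c := by rw [← h, mul_assoc]
  have hk : ∀ t : k, F (algebraMap k A t) ∈ (algebraMap K Q).range := by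
    intro t
    rw [hcenter]
    apply hcent
    intro r
    obtain ⟨r, rfl⟩ := J.ringCon.mk'_surjective r
    change f (J.ringCon.mk' _) * _ = _ * f (J.ringCon.mk' _)
    rw [← map_mul, ← map_mul, ← map_mul, ← map_mul, Algebra.commutes]
  let e0 : K ≃+* (algebraMap K Q).range :=
    RingEquiv.ofBijective (algebraMap K Q).rangeRestrict
      ⟨fun x y h => (algebraMap K Q).injective (congrArg Subtype.val h),
        (algebraMap K Q).rangeRestrict_surjective⟩
  let σ : k →+* K := (e0.symm : _ →+* K).comp
    ((F.comp (algebraMap k A)).codRestrict (algebraMap K Q).range hk)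
  have hσ : ∀ t, algebraMap K Q (σ t) = F (algebraMap k A t) := by
    intro t
    have := e0.apply_symm_apply ⟨F (algebraMap k A t), hk t⟩
    exact congrArg Subtype.val this
  let C := AlgebraicClosure K
  have hs : IsSimpleRing (C ⊗[K] Q) := tensor_simple K Q C hcenter
  obtain ⟨d, hd, ⟨e⟩⟩ := IsSimpleRing.exists_algEquiv_matrix_of_isAlgClosed C (C ⊗[K] Q)
  have hdn : d = n := by
    have h1 := e.toLinearEquiv.finrank_eq
    rw [Module.finrank_baseChange, hfin, Module.finrank_matrix] at h1
    simp only [Fintype.card_fin, Module.finrank_self, mul_one, ← sq] at h1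
    exact (Nat.pow_left_injective (two_ne_zero) h1).symm
  subst hdn
  let φ0 : A →+* Matrix (Fin d) (Fin d) C :=
    ((e : C ⊗[K] Q →+* Matrix (Fin d) (Fin d) C).comp
      (Algebra.TensorProduct.includeRight : Q →ₐ[K] C ⊗[K] Q).toRingHom).comp F
  have hφ0 : ∀ a, φ0 a = e (1 ⊗ₜ F a) := fun a => rfl
  letI : Algebra k C := ((algebraMap K C).comp σ).toAlgebra
  let φ : A →ₐ[k] Matrix (Fin d) (Fin d) C :=
    { φ0 with
      commutes' := fun t => by
        change φ0 _ = _
        rw [hφ0, ← hσ]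
        have : (1 : C) ⊗ₜ[K] (algebraMap K Q (σ t)) = algebraMap C (C ⊗[K] Q) (algebraMap K C (σ t)) := by
          rw [Algebra.algebraMap_eq_smul_one, ← TensorProduct.smul_tmul, ← Algebra.algebraMap_eq_smul_one]
          rfl
        rw [this, AlgEquiv.commutes]
        rfl }
  have hφ : ∀ a, φ a = e (1 ⊗ₜ F a) := fun a => rfl
  refine ⟨C, inferInstance, inferInstance, inferInstance, φ, ?_, ?_⟩
  · intro p
    rw [hφ, EmbeddingLike.map_eq_zero_iff, ← hF0]
    have hi : Function.Injective (Algebra.TensorProduct.includeRight : Q →ₐ[K] C ⊗[K] Q) :=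
      Algebra.TensorProduct.includeRight_injective (algebraMap K C).injective
    exact map_eq_zero_iff _ hi
  · rw [eq_top_iff]
    intro M _
    obtain ⟨x, rfl⟩ := e.surjective M
    induction x using TensorProduct.induction_on with
    | zero => rw [map_zero]; exact zero_mem _
    | add x y h1 h2 => rw [map_add]; exact add_mem (h1 trivial) (h2 trivial)
    | tmul c q =>
      obtain ⟨r, z, hz, hz0, h⟩ := hfrac q
      obtain ⟨s, hs⟩ : f z ∈ (algebraMap K Q).range := by
        rw [hcenter]
        apply hcent
        intro r
        rw [← map_mul, ← map_mul, (Subring.mem_center_iff.1 hz r)]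
      have hs0 : s ≠ 0 := by
        rintro rfl
        rw [map_zero] at hs
        exact hz0 ((map_eq_zero_iff f hinj).1 hs.symm)
      obtain ⟨a, rfl⟩ := J.ringCon.mk'_surjective r
      have h : F a = q * f z := h.symm
      have : q = s⁻¹ • F a := by
        rw [h, ← hs, ← Algebra.commutes, ← Algebra.smul_def, smul_smul, inv_mul_cancel₀ hs0, one_smul]
      have h3 : e (c ⊗ₜ q) = (s⁻¹ • c) • φ a := by
        rw [hφ, ← map_smul, this, TensorProduct.tmul_smul, TensorProduct.smul_tmul']
        congr 1
        rw [TensorProduct.smul_tmul', smul_eq_mul, mul_one]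
      rw [h3]
      exact Submodule.smul_mem _ _ (Submodule.subset_span ⟨a, rfl⟩)
end

section
open Matrix

theorem derivative_charpoly_eq {R : Type*} [CommRing R] {n : ℕ} (A : Matrix (Fin n) (Fin n) R) :
    Polynomial.derivative A.charpoly = (adjugate (charmatrix A)).trace := by
  rw [Matrix.charpoly, ← Matrix.det_transpose, Matrix.det_apply', map_sum, Matrix.trace]
  simp only [Matrix.diag_apply, Matrix.adjugate_apply]
  have h1 : ∀ i, (A.charmatrix.updateRow i (Pi.single i 1)).det =
      ∑ σ : Equiv.Perm (Fin n), (Equiv.Perm.sign σ : Polynomial R) *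
        ((∏ j ∈ Finset.univ.erase i, A.charmatrix j (σ j)) * (if σ i = i then 1 else 0)) := by
    intro i
    rw [← Matrix.det_transpose, Matrix.det_apply']
    refine Finset.sum_congr rfl fun σ _ => ?_
    congr 1
    rw [← Finset.prod_erase_mul _ _ (Finset.mem_univ i)]
    congr 1
    · refine Finset.prod_congr rfl fun j hj => ?_
      rw [Matrix.transpose_apply, Matrix.updateRow_ne (Finset.ne_of_mem_erase hj)]
    · rw [Matrix.transpose_apply, Matrix.updateRow_self, Pi.single_apply]
  simp only [h1]
  rw [Finset.sum_comm]
  refine Finset.sum_congr rfl fun σ _ => ?_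
  rw [← Finset.mul_sum, Polynomial.derivative_intCast_mul, Polynomial.derivative_prod_finset]
  congr 1
  refine Finset.sum_congr rfl fun i _ => ?_
  congr 1
  rw [Matrix.transpose_apply, Matrix.charmatrix_apply, Matrix.diagonal_apply]
  by_cases h : σ i = i
  · simp [h]
  · simp [h, Ne.symm h]

theorem charpoly_coeff_mem {k R : Type*} [Field k] [CharZero k] [CommRing R] [Algebra k R] {n : ℕ}
    (S : Subalgebra k (Matrix (Fin n) (Fin n) R))
    (hS : ∀ p ∈ S, algebraMap R (Matrix (Fin n) (Fin n) R) p.trace ∈ S)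
    {A : Matrix (Fin n) (Fin n) R} (hA : A ∈ S) (i : ℕ) :
    algebraMap R (Matrix (Fin n) (Fin n) R) (A.charpoly.coeff i) ∈ S := by
  let B : ℕ → Matrix (Fin n) (Fin n) R := fun i => (adjugate (charmatrix A)).map (fun p => p.coeff i)
  have hmul : charmatrix A * adjugate (charmatrix A) = A.charpoly • 1 := Matrix.mul_adjugate _
  have hent : ∀ p q, Polynomial.X * adjugate (charmatrix A) p q
      - ∑ r, Polynomial.C (A p r) * adjugate (charmatrix A) r q = A.charpoly * (1 : Matrix (Fin n) (Fin n) _) p q := by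
    intro p q
    have := congrFun (congrFun hmul p) q
    have h2 : charmatrix A * adjugate (charmatrix A) = Matrix.scalar (Fin n) Polynomial.X * adjugate (charmatrix A)
        - A.map Polynomial.C * adjugate (charmatrix A) := by
      rw [← sub_mul]; rfl
    rw [h2] at this
    simpa [Matrix.sub_apply, Matrix.mul_apply, Matrix.diagonal_apply] using this
  have hrec : ∀ i, B i = A * B (i+1) + algebraMap R _ (A.charpoly.coeff (i+1)) := by
    intro i
    ext p q
    have := congrArg (fun f => Polynomial.coeff f (i+1)) (hent p q)
    simp only [Polynomial.coeff_sub, Polynomial.coeff_X_mul, Polynomial.finsetSum_coeff,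
      Polynomial.coeff_C_mul] at this
    rw [Matrix.add_apply, Matrix.mul_apply, ← sub_eq_iff_eq_add']
    refine this.trans ?_
    by_cases h : p = q
    · subst h; simp [Matrix.algebraMap_matrix_apply]
    · simp [Matrix.algebraMap_matrix_apply, h]
  have hrec0 : algebraMap R _ (A.charpoly.coeff 0) = - (A * B 0) := by
    ext p q
    have := congrArg (fun f => Polynomial.coeff f 0) (hent p q)
    simp only [Polynomial.coeff_sub, Polynomial.coeff_X_mul_zero, Polynomial.finsetSum_coeff,
      Polynomial.coeff_C_mul, zero_sub] at this
    rw [Matrix.neg_apply, Matrix.mul_apply]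
    refine Eq.trans ?_ this.symm
    by_cases h : p = q
    · subst h; simp [Matrix.algebraMap_matrix_apply]
    · simp [Matrix.algebraMap_matrix_apply, h]
  have htr : ∀ i, (B i).trace = A.charpoly.coeff (i+1) * (i+1) := by
    intro i
    have := congrArg (fun f => Polynomial.coeff f i) (derivative_charpoly_eq A)
    simp only [Polynomial.coeff_derivative] at this
    rw [this, Matrix.trace, Matrix.trace, Polynomial.finsetSum_coeff]
    rfl
  have hc : ∀ i, B (i+1) ∈ S → algebraMap R (Matrix (Fin n) (Fin n) R) (A.charpoly.coeff (i+1)) ∈ S := by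
    intro i hB
    have h1 := congrArg Matrix.trace (hrec i)
    rw [htr, Matrix.trace_add, Algebra.algebraMap_eq_smul_one, Matrix.trace_smul, Matrix.trace_one,
      Fintype.card_fin, smul_eq_mul] at h1
    by_cases hi : i + 1 = n
    · cases subsingleton_or_nontrivial R
      · rw [Subsingleton.elim (A.charpoly.coeff (i+1)) 0, map_zero]; exact zero_mem _
      have h2 : A.charpoly.coeff (i+1) = 1 := by
        have h3 := A.charpoly_natDegree_eq_dim
        rw [Fintype.card_fin] at h3
        have := A.charpoly_monic
        rw [Polynomial.Monic, Polynomial.leadingCoeff, h3] at this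
        rw [hi]; exact this
      rw [h2, map_one]; exact one_mem _
    · have h2 : ((i + 1 : k) - n) ≠ 0 := by
        rw [sub_ne_zero]; exact_mod_cast hi
      have h3 : A.charpoly.coeff (i+1) = ((i + 1 : k) - n)⁻¹ • (A * B (i+1)).trace := by
        rw [eq_inv_smul_iff₀ h2, Algebra.smul_def]
        simp only [map_sub, map_add, map_natCast, map_one]
        linear_combination h1
      rw [h3, Algebra.algebraMap_eq_smul_one, smul_assoc, ← Algebra.algebraMap_eq_smul_one]
      exact S.smul_mem (hS _ (mul_mem hA hB)) _
  have hB : ∀ i, B i ∈ S := by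
    obtain ⟨N, hN⟩ : ∃ N, ∀ i ≥ N, B i = 0 := by
      refine ⟨(Finset.univ.sup fun pq : Fin n × Fin n => (adjugate (charmatrix A) pq.1 pq.2).natDegree) + 1, ?_⟩
      intro i hi
      ext p q
      change (adjugate (charmatrix A) p q).coeff i = 0
      apply Polynomial.coeff_eq_zero_of_natDegree_lt
      have := Finset.le_sup (f := fun pq : Fin n × Fin n => (adjugate (charmatrix A) pq.1 pq.2).natDegree)
        (Finset.mem_univ (p, q))
      simp only at this
      omega
    have : ∀ j i, N ≤ i + j → B i ∈ S := by
      intro j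
      induction j with
      | zero => intro i hi; rw [hN i hi]; exact zero_mem _
      | succ j ih =>
        intro i hi
        rw [hrec]
        have := ih (i+1) (by omega)
        exact add_mem (mul_mem hA this) (hc i this)
    exact fun i => this N i (by omega)
  cases i with
  | zero => rw [hrec0]; exact neg_mem (mul_mem hA (hB 0))
  | succ i => exact hc i (hB _)

theorem rep_trace_sep {k R C : Type} [Field k] [CharZero k] [CommRing R] [Algebra k R] {n : ℕ} [NeZero n]
    (S : Subalgebra k (Matrix (Fin n) (Fin n) R))
    (hS : ∀ p ∈ S, algebraMap R (Matrix (Fin n) (Fin n) R) p.trace ∈ S)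
    [Field C] [IsAlgClosed C] [Algebra k C] (φ : S →ₐ[k] Matrix (Fin n) (Fin n) C)
    (hφ : Submodule.span C (Set.range φ) = ⊤) (p : S) (hp : cdisc (φ p) ≠ 0) :
    φ ⟨_, hS p p.2⟩ = algebraMap C _ (φ p).trace := by
  have : CharZero C := charZero_of_injective_algebraMap (algebraMap k C).injective
  have hsep := (cdisc_ne_zero_iff _).1 hp
  have hnt : Nontrivial R := by
    by_contra h
    rw [not_nontrivial_iff_subsingleton] at h
    have h1 : (1 : S) = 0 := Subtype.ext (Subsingleton.elim _ _)
    have := congrArg φ h1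
    simp at this
  have hex : ∀ i, ∃ γ : C, φ ⟨_, charpoly_coeff_mem S hS p.2 i⟩ = algebraMap C _ γ := by
    intro i
    apply scalar_of_commute φ hφ
    intro r
    rw [← map_mul, ← map_mul]
    congr 1
    apply Subtype.ext
    exact Algebra.commutes _ _
  choose γ hγ using hex
  have hdeg : (p : Matrix (Fin n) (Fin n) R).charpoly.natDegree = n := by
    rw [Matrix.charpoly_natDegree_eq_dim, Fintype.card_fin]
  have hγn : γ n = 1 := by
    have h1 : (p : Matrix (Fin n) (Fin n) R).charpoly.coeff n = 1 := by
      have := (p : Matrix (Fin n) (Fin n) R).charpoly_monic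
      rwa [Polynomial.Monic, Polynomial.leadingCoeff, hdeg] at this
    have h2 := hγ n
    have h3 : (⟨_, charpoly_coeff_mem S hS p.2 n⟩ : S) = 1 := by
      apply Subtype.ext
      simp [h1]
    rw [h3, map_one, ← map_one (algebraMap C (Matrix (Fin n) (Fin n) C))] at h2
    exact ((algebraMap C (Matrix (Fin n) (Fin n) C)).injective h2).symm
  let g : Polynomial C := ∑ i ∈ Finset.range (n+1), Polynomial.monomial i (γ i)
  have hgc : ∀ i ≤ n, g.coeff i = γ i := by
    intro i hi
    simp only [g, Polynomial.finsetSum_coeff, Polynomial.coeff_monomial]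
    rw [Finset.sum_ite_eq' ]
    simp [Nat.lt_succ_of_le hi]
  have hgdeg : g.natDegree ≤ n := by
    apply Polynomial.natDegree_sum_le_of_forall_le
    intro i hi
    exact (Polynomial.natDegree_monomial_le _).trans (by simpa [Nat.lt_succ_iff] using hi)
  have hgm : g.Monic := Polynomial.monic_of_natDegree_le_of_coeff_eq_one n hgdeg (by rw [hgc n le_rfl, hγn])
  have hg0 : Polynomial.aeval (φ p) g = 0 := by
    have hCH := Matrix.aeval_self_charpoly (p : Matrix (Fin n) (Fin n) R)
    rw [Polynomial.aeval_eq_sum_range, hdeg] at hCH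
    have h1 : ∑ i ∈ Finset.range (n+1), (⟨_, charpoly_coeff_mem S hS p.2 i⟩ : S) * p ^ i = 0 := by
      apply Subtype.ext
      simp only [Algebra.smul_def] at hCH
      simpa using hCH
    have h2 := congrArg φ h1
    simp only [map_sum, map_mul, map_pow, hγ, map_zero] at h2
    rw [← h2]
    simp only [g, map_sum, Polynomial.aeval_monomial]
  have hdvd : (φ p).charpoly ∣ g := by
    apply Polynomial.Splits.dvd_of_roots_le_roots (IsAlgClosed.splits _) (Matrix.charpoly_monic _).ne_zero
    rw [Multiset.le_iff_subset (Polynomial.nodup_roots hsep)]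
    intro r hr
    rw [Polynomial.mem_roots (Matrix.charpoly_monic _).ne_zero] at hr
    rw [Polynomial.mem_roots hgm.ne_zero]
    have h1 := Matrix.mem_spectrum_of_isRoot_charpoly hr
    have h2 := spectrum.subset_polynomial_aeval (φ p) g ⟨r, h1, rfl⟩
    rw [hg0, spectrum.zero_eq] at h2
    exact h2
  have heq : (φ p).charpoly = g := by
    symm
    apply Polynomial.eq_of_monic_of_dvd_of_natDegree_le (Matrix.charpoly_monic _) hgm hdvd
    rw [Matrix.charpoly_natDegree_eq_dim, Fintype.card_fin]
    exact hgdeg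
  have h1 : (φ p).trace = - γ (n-1) := by
    rw [Matrix.trace_eq_neg_charpoly_coeff, heq, Fintype.card_fin, hgc _ (by omega)]
  have h2 : (⟨_, hS p p.2⟩ : S) = - ⟨_, charpoly_coeff_mem S hS p.2 (n-1)⟩ := by
    apply Subtype.ext
    change algebraMap R (Matrix (Fin n) (Fin n) R) _ = - algebraMap R (Matrix (Fin n) (Fin n) R) _
    rw [Matrix.trace_eq_neg_charpoly_coeff, Fintype.card_fin, map_neg]
  rw [h2, map_neg, hγ, h1, map_neg]

theorem rep_trace {k R C : Type} [Field k] [CharZero k] [CommRing R] [Algebra k R] {n : ℕ} [NeZero n]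
    (S : Subalgebra k (Matrix (Fin n) (Fin n) R))
    (hS : ∀ p ∈ S, algebraMap R (Matrix (Fin n) (Fin n) R) p.trace ∈ S)
    [Field C] [IsAlgClosed C] [Algebra k C] (φ : S →ₐ[k] Matrix (Fin n) (Fin n) C)
    (hφ : Submodule.span C (Set.range φ) = ⊤) (p : S) :
    φ ⟨_, hS p p.2⟩ = algebraMap C _ (φ p).trace := by
  have : CharZero C := charZero_of_injective_algebraMap (algebraMap k C).injective
  obtain ⟨x, hx⟩ := exists_sep φ hφ
  obtain ⟨t, ht, hxt⟩ := exists_sep_line φ x p hx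
  have h1 := rep_trace_sep S hS φ hφ x hx
  have h2 := rep_trace_sep S hS φ hφ _ hxt
  have h3 : (⟨_, hS _ (x + t • p).2⟩ : S) = ⟨_, hS x x.2⟩ + t • ⟨_, hS p p.2⟩ := by
    apply Subtype.ext
    change algebraMap R (Matrix (Fin n) (Fin n) R) ((x : Matrix (Fin n) (Fin n) R) + t • (p : Matrix (Fin n) (Fin n) R)).trace
      = algebraMap R _ _ + t • algebraMap R _ _
    rw [Matrix.trace_add, Matrix.trace_smul, map_add]
    congr 1
    rw [Algebra.algebraMap_eq_smul_one, Algebra.algebraMap_eq_smul_one, smul_assoc]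
  rw [h3, map_add, map_smul, h1, map_add, map_smul, Matrix.trace_add, map_add, add_right_inj,
    Matrix.trace_smul] at h2
  have h4 : algebraMap C (Matrix (Fin n) (Fin n) C) (t • (φ p).trace) = t • algebraMap C _ (φ p).trace := by
    rw [Algebra.algebraMap_eq_smul_one, Algebra.algebraMap_eq_smul_one, smul_assoc]
  rw [h4] at h2
  exact smul_right_injective _ ht h2
end

section
open Matrix

/-- inclusion as algebra map -/
noncomputable def inclA (k : Type) [Field k] (n m : ℕ) : GMN k n m →ₐ[k] TMN k n m :=
  Subalgebra.inclusion (show GMN k n m ≤ TMN k n m from fun _ hx => Algebra.subset_adjoin (Or.inl hx))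

theorem TMN_induction (k : Type) [Field k] (n m : ℕ) (P : TMN k n m → Prop)
    (hG : ∀ g : GMN k n m, P (inclA k n m g))
    (htr : ∀ (g : GMN k n m) (h : traceScalar k (g : MatPoly k n m) ∈ TMN k n m), P ⟨_, h⟩)
    (hadd : ∀ x y, P x → P y → P (x + y)) (hmul : ∀ x y, P x → P y → P (x * y)) (p : TMN k n m) :
    P p := by
  obtain ⟨p, hp⟩ := p
  refine Algebra.adjoin_induction (p := fun p hp => P ⟨p, hp⟩) ?_ ?_ ?_ ?_ hp
  · rintro x (hx | ⟨g, hg, rfl⟩)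
    · exact hG ⟨x, hx⟩
    · exact htr ⟨g, hg⟩ _
  · intro r
    exact hG (algebraMap k _ r)
  · intro x y hx hy h1 h2
    exact hadd ⟨x, hx⟩ ⟨y, hy⟩ h1 h2
  · intro x y hx hy h1 h2
    exact hmul ⟨x, hx⟩ ⟨y, hy⟩ h1 h2

theorem TMN_span (k : Type) [Field k] (n m : ℕ) :
    Submodule.span k {x : TMN k n m | ∃ c : TMN k n m,
      (∃ a, (c : MatPoly k n m) = algebraMap (PolyRing k n m) _ a) ∧
      ∃ g : GMN k n m, x = c * inclA k n m g} = ⊤ := by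
  set U := {x : TMN k n m | ∃ c : TMN k n m,
      (∃ a, (c : MatPoly k n m) = algebraMap (PolyRing k n m) _ a) ∧
      ∃ g : GMN k n m, x = c * inclA k n m g} with hU
  rw [eq_top_iff]
  intro p _
  induction p using TMN_induction with
  | hG g => exact Submodule.subset_span ⟨1, ⟨1, by simp⟩, g, by simp⟩
  | htr g h => exact Submodule.subset_span ⟨⟨_, h⟩, ⟨_, rfl⟩, 1, by simp⟩
  | hadd x y hx hy => exact add_mem (hx trivial) (hy trivial)
  | hmul x y hx hy =>
    have h1 := Submodule.mul_mem_mul (hx trivial) (hy trivial)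
    rw [Submodule.span_mul_span] at h1
    refine Submodule.span_mono ?_ h1
    rintro _ ⟨_, ⟨c, ⟨a, ha⟩, g, rfl⟩, _, ⟨c', ⟨a', ha'⟩, g', rfl⟩, rfl⟩
    refine ⟨c * c', ⟨a * a', by simp [ha, ha']⟩, g * g', ?_⟩
    have hcomm : inclA k n m g * c' = c' * inclA k n m g := by
      apply Subtype.ext
      change (g : MatPoly k n m) * (c' : MatPoly k n m) = c' * g
      rw [ha']; exact (Algebra.commutes _ _).symm
    change c * inclA k n m g * (c' * inclA k n m g') = _
    rw [map_mul]
    calc _ = c * (inclA k n m g * c') * inclA k n m g' := by simp only [mul_assoc]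
      _ = _ := by rw [hcomm]; simp only [mul_assoc]

theorem traceScalar_mem (k : Type) [Field k] (n m : ℕ) (p : MatPoly k n m) (hp : p ∈ TMN k n m) :
    traceScalar k p ∈ TMN k n m := by
  have h : (⟨p, hp⟩ : TMN k n m) ∈ (⊤ : Submodule k (TMN k n m)) := trivial
  rw [← TMN_span] at h
  suffices ∀ q : TMN k n m, q ∈ Submodule.span k {x : TMN k n m | ∃ c : TMN k n m,
      (∃ a, (c : MatPoly k n m) = algebraMap (PolyRing k n m) _ a) ∧
      ∃ g : GMN k n m, x = c * inclA k n m g} → traceScalar k (q : MatPoly k n m) ∈ TMN k n m from this _ h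
  intro q hq
  induction hq using Submodule.span_induction with
  | mem x h =>
    obtain ⟨c, ⟨a, ha⟩, g, rfl⟩ := h
    have : traceScalar k ((c * inclA k n m g : TMN k n m) : MatPoly k n m)
        = (c : MatPoly k n m) * traceScalar k (g : MatPoly k n m) := by
      change traceScalar k ((c : MatPoly k n m) * (g : MatPoly k n m)) = _
      rw [ha, ← Algebra.smul_def, traceScalar, Matrix.trace_smul, smul_eq_mul, map_mul]
      rfl
    rw [this]
    exact mul_mem c.2 (Algebra.subset_adjoin (Or.inr ⟨g, g.2, rfl⟩))
  | zero => simp [traceScalar]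
  | add x y _ _ h1 h2 =>
    have := add_mem h1 h2
    simpa [traceScalar] using this
  | smul c x _ h =>
    have := (TMN k n m).smul_mem h c
    have e : traceScalar k ((c • x : TMN k n m) : MatPoly k n m) = c • traceScalar k (x : MatPoly k n m) := by
      change algebraMap (PolyRing k n m) (MatPoly k n m) (c • (x : MatPoly k n m)).trace = c • algebraMap _ _ _
      rw [Matrix.trace_smul, Algebra.algebraMap_eq_smul_one, Algebra.algebraMap_eq_smul_one, smul_assoc]
    rwa [e]

theorem full_restrict {k C : Type} [Field k] [Field C] [Algebra k C] {n m : ℕ}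
    (φ : TMN k n m →ₐ[k] Matrix (Fin n) (Fin n) C) (hφ : Submodule.span C (Set.range φ) = ⊤) :
    Submodule.span C (Set.range (φ.comp (inclA k n m))) = ⊤ := by
  rw [eq_top_iff, ← hφ, Submodule.span_le]
  rintro _ ⟨p, rfl⟩
  have hp : p ∈ (⊤ : Submodule k (TMN k n m)) := trivial
  rw [← TMN_span] at hp
  change φ p ∈ Submodule.span C (Set.range (φ.comp (inclA k n m)))
  induction hp using Submodule.span_induction with
  | mem x h =>
    obtain ⟨c, ⟨a, ha⟩, g, rfl⟩ := h
    obtain ⟨γ, hγ⟩ := scalar_of_commute φ hφ (φ c) (fun r => by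
      rw [← map_mul, ← map_mul]
      congr 1
      apply Subtype.ext
      change (c : MatPoly k n m) * (r : MatPoly k n m) = r * c
      rw [ha]; exact Algebra.commutes _ _)
    rw [map_mul, hγ, ← Algebra.smul_def]
    exact Submodule.smul_mem _ _ (Submodule.subset_span ⟨g, rfl⟩)
  | zero => rw [map_zero]; exact zero_mem _
  | add x y _ _ h1 h2 => rw [map_add]; exact add_mem h1 h2
  | smul c x _ h =>
    rw [map_smul, ← algebraMap_smul C c]
    exact Submodule.smul_mem _ _ h

theorem TMN_rep_trace {k C : Type} [Field k] [CharZero k] [Field C] [IsAlgClosed C] [Algebra k C] {n m : ℕ}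
    [NeZero n] (φ : TMN k n m →ₐ[k] Matrix (Fin n) (Fin n) C) (hφ : Submodule.span C (Set.range φ) = ⊤)
    (p : TMN k n m) : φ ⟨traceScalar k (p : MatPoly k n m), traceScalar_mem k n m p p.2⟩ =
      algebraMap C _ (φ p).trace :=
  rep_trace (TMN k n m) (traceScalar_mem k n m) φ hφ p

theorem trace_of_symm {C V : Type*} [Field C] [AddCommGroup V] [Module C V] {n : ℕ} [NeZero n]
    (L : Matrix (Fin n) (Fin n) C →ₗ[C] V) (h : ∀ M N, L (M * N) = L (N * M)) (M : Matrix (Fin n) (Fin n) C) :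
    (n : C) • L M = M.trace • L 1 := by
  have h1 : ∀ i j, i ≠ j → L (Matrix.single i j 1) = 0 := by
    intro i j hij
    have := h (Matrix.single i i 1) (Matrix.single i j 1)
    rw [Matrix.single_mul_single_same, Matrix.single_mul_single_of_ne _ _ _ _ hij.symm] at this
    simpa using this
  have h2 : ∀ i, L (Matrix.single i i 1) = L (Matrix.single 0 0 1) := by
    intro i
    have := h (Matrix.single i 0 1) (Matrix.single 0 i 1)
    rw [Matrix.single_mul_single_same, Matrix.single_mul_single_same] at this
    simpa using this
  have key : ∀ M, L M = M.trace • L (Matrix.single 0 0 1) := by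
    intro M
    conv_lhs => rw [Matrix.matrix_eq_sum_single M]
    simp only [map_sum]
    rw [Matrix.trace, Finset.sum_smul]
    refine Finset.sum_congr rfl fun i _ => ?_
    rw [Finset.sum_eq_single i]
    · have : Matrix.single i i (M i i) = M i i • Matrix.single i i (1:C) := by simp
      rw [this, map_smul, h2]; rfl
    · intro j _ hj
      have : Matrix.single i j (M i j) = M i j • Matrix.single i j (1:C) := by simp
      rw [this, map_smul, h1 i j hj.symm, smul_zero]
    · simp
  rw [key M, key 1, Matrix.trace_one, Fintype.card_fin, smul_smul, smul_smul, mul_comm]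

theorem inj_aux {k C D : Type} [Field k] [CharZero k] [Field C] [IsAlgClosed C] [Algebra k C]
    [Field D] [IsAlgClosed D] [Algebra k D] {n m : ℕ} [NeZero n]
    (φ : TMN k n m →ₐ[k] Matrix (Fin n) (Fin n) C) (hφ : Submodule.span C (Set.range φ) = ⊤)
    (ψ : TMN k n m →ₐ[k] Matrix (Fin n) (Fin n) D) (hψ : Submodule.span D (Set.range ψ) = ⊤)
    (h : ∀ g, φ (inclA k n m g) = 0 ↔ ψ (inclA k n m g) = 0) (p : TMN k n m) (hp : φ p = 0) :
    ψ p = 0 := by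
  have hC : CharZero C := charZero_of_injective_algebraMap (algebraMap k C).injective
  have hD : CharZero D := charZero_of_injective_algebraMap (algebraMap k D).injective
  have hnC : (n : C) ≠ 0 := by exact_mod_cast NeZero.ne n
  have hnD : (n : D) ≠ 0 := by exact_mod_cast NeZero.ne n
  have hφG := full_restrict φ hφ
  have hψG := full_restrict ψ hψ
  set φG := φ.comp (inclA k n m) with hφGd
  set ψG := ψ.comp (inclA k n m) with hψGd
  have h : ∀ g, φG g = 0 ↔ ψG g = 0 := h
  obtain ⟨ι, _, a, b, z, hz, ht⟩ := trace_op φG hφG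
  let t : GMN k n m → GMN k n m := fun g => ∑ i, a i * g * b i
  have htφ : ∀ g, φG (t g) = (z * (φG g).trace) • 1 := by
    intro g
    rw [← ht]; simp [t]
  let c := t 1
  have hcφ : φG c = (z * n) • 1 := by rw [htφ]; simp
  have eqv : ∀ x y, φG x = φG y → ψG x = ψG y := by
    intro x y hxy
    rw [← sub_eq_zero, ← map_sub, ← h, map_sub, hxy, sub_self]
  -- c is a nonzero scalar for ψ
  obtain ⟨ζ, hζ⟩ := scalar_of_commute ψG hψG (ψG c) (fun r => by
    rw [← map_mul, ← map_mul]
    apply eqv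
    rw [map_mul, map_mul, hcφ]; simp)
  have hζ0 : ζ ≠ 0 := by
    rintro rfl
    rw [map_zero, ← h, hcφ, smul_eq_zero] at hζ
    rcases hζ with h | h
    · exact (mul_ne_zero hz hnC) h
    · exact one_ne_zero h
  let L : Matrix (Fin n) (Fin n) D →ₗ[D] Matrix (Fin n) (Fin n) D :=
    ∑ i, (LinearMap.mulLeft D (ψG (a i))).comp (LinearMap.mulRight D (ψG (b i)))
  have hL : ∀ M, L M = ∑ i, ψG (a i) * M * ψG (b i) := by
    intro M; simp [L, LinearMap.sum_apply, mul_assoc]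
  have hLt : ∀ g, L (ψG g) = ψG (t g) := by
    intro g; rw [hL]; simp [t]
  have hsymm : ∀ M N, L (M * N) = L (N * M) := by
    have h1 : ∀ (g : GMN k n m) N, L (ψG g * N) = L (N * ψG g) := by
      intro g N
      have hN : N ∈ Submodule.span D (Set.range ψG) := by rw [hψG]; trivial
      induction hN using Submodule.span_induction with
      | mem N h' =>
        obtain ⟨r, rfl⟩ := h'
        rw [← map_mul, ← map_mul, hLt, hLt]
        apply eqv
        rw [htφ, htφ, map_mul, map_mul, Matrix.trace_mul_comm]
      | zero => simp
      | add N N' _ _ h1 h2 => simp only [add_mul, mul_add, map_add, h1, h2]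
      | smul c N _ h1 => simp only [smul_mul_assoc, mul_smul_comm, map_smul, h1]
    intro M N
    have hM : M ∈ Submodule.span D (Set.range ψG) := by rw [hψG]; trivial
    induction hM using Submodule.span_induction with
    | mem M h' => obtain ⟨r, rfl⟩ := h'; exact h1 r N
    | zero => simp
    | add N N' _ _ h1 h2 => simp only [add_mul, mul_add, map_add, h1, h2]
    | smul c N _ h1 => simp only [smul_mul_assoc, mul_smul_comm, map_smul, h1]
  have hLtr := trace_of_symm L hsymm
  let Φ : TMN k n m →ₐ[k] Matrix (Fin n) (Fin n) C × Matrix (Fin n) (Fin n) D := φ.prod ψ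
  let c' := inclA k n m c
  have hcc : ∀ x, Φ c' * x = x * Φ c' := by
    rintro ⟨x, y⟩
    change (φG c * x, ψG c * y) = (x * φG c, y * ψG c)
    rw [hcφ, hζ, Algebra.commutes]
    simp
  have hcp : ∀ (l : ℕ) x, Φ c' ^ l * x = x * Φ c' ^ l := fun l x =>
    (Commute.pow_left (show Commute (Φ c') x from hcc x) l)
  have key : ∀ p : TMN k n m, ∃ (l : ℕ) (q : GMN k n m), Φ c' ^ l * Φ p = Φ (inclA k n m q) := by
    intro p
    induction p using TMN_induction with
    | hG g => exact ⟨0, g, by simp⟩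
    | htr g hg =>
      refine ⟨1, (n : k) • t g, ?_⟩
      rw [pow_one]
      have e1 : φ ⟨_, hg⟩ = algebraMap C _ (φG g).trace := TMN_rep_trace φ hφ (inclA k n m g)
      have e2 : ψ ⟨_, hg⟩ = algebraMap D _ (ψG g).trace := TMN_rep_trace ψ hψ (inclA k n m g)
      change (φG c * φ ⟨_, hg⟩, ψG c * ψ ⟨_, hg⟩) = (φG ((n:k) • t g), ψG ((n:k) • t g))
      rw [e1, e2, map_smul, map_smul]
      congr 1
      · rw [hcφ, htφ, ← algebraMap_smul C (n : k), map_natCast, smul_smul, ← Algebra.commutes,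
          ← Algebra.smul_def, smul_smul]
        congr 1; ring
      · have := hLtr (ψG g)
        have e3 : L 1 = ψG c := by
          have h1 := hLt 1
          rwa [map_one ψG] at h1
        rw [hLt, e3] at this
        rw [← algebraMap_smul D (n : k), map_natCast, this, ← Algebra.commutes, Algebra.smul_def]
    | hadd x y hx hy =>
      obtain ⟨l, q, h1⟩ := hx
      obtain ⟨l', q', h2⟩ := hy
      refine ⟨l + l', c ^ l' * q + c ^ l * q', ?_⟩
      simp only [map_add, map_mul, map_pow]
      change _ = Φ c' ^ l' * Φ _ + Φ c' ^ l * Φ _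
      rw [← h1, ← h2, mul_add, ← mul_assoc, ← mul_assoc, ← pow_add, ← pow_add, add_comm l' l]
    | hmul x y hx hy =>
      obtain ⟨l, q, h1⟩ := hx
      obtain ⟨l', q', h2⟩ := hy
      refine ⟨l + l', q * q', ?_⟩
      simp only [map_mul]
      rw [← h1, ← h2, pow_add]
      calc _ = Φ c' ^ l * (Φ c' ^ l' * Φ x) * Φ y := by simp only [mul_assoc]
        _ = _ := by rw [hcp l']; simp only [mul_assoc]
  obtain ⟨l, q, hq⟩ := key p
  have h1 : φG c ^ l * φ p = φG q := congrArg Prod.fst hq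
  have h2 : ψG c ^ l * ψ p = ψG q := congrArg Prod.snd hq
  rw [hp, mul_zero] at h1
  rw [(h q).1 h1.symm, hζ, ← map_pow, ← Algebra.smul_def, smul_eq_zero] at h2
  rcases h2 with h2 | h2
  · exact absurd h2 (pow_ne_zero _ hζ0)
  · exact h2

/-- evaluation at a tuple over an extension field -/
noncomputable def evC {k C : Type} [Field k] [Field C] [Algebra k C] {n m : ℕ}
    (a : Fin m → Matrix (Fin n) (Fin n) C) : MatPoly k n m →ₐ[k] Matrix (Fin n) (Fin n) C :=
  (MvPolynomial.aeval fun x : MIdx n m => a x.1 x.2.1 x.2.2 : PolyRing k n m →ₐ[k] C).mapMatrix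

theorem evC_generic {k C : Type} [Field k] [Field C] [Algebra k C] {n m : ℕ}
    (a : Fin m → Matrix (Fin n) (Fin n) C) (h : Fin m) : evC (k := k) a (genericMatrix k n m h) = a h := by
  ext i j
  simp [evC, genericMatrix]

theorem extend_rep {k C : Type} [Field k] [Field C] [Algebra k C] {n m : ℕ}
    (φ : GMN k n m →ₐ[k] Matrix (Fin n) (Fin n) C) :
    ∃ ψ : TMN k n m →ₐ[k] Matrix (Fin n) (Fin n) C, ∀ g, ψ (inclA k n m g) = φ g := by
  let a : Fin m → Matrix (Fin n) (Fin n) C := fun h =>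
    φ ⟨genericMatrix k n m h, Algebra.subset_adjoin ⟨h, rfl⟩⟩
  refine ⟨(evC a).comp (TMN k n m).val, ?_⟩
  rintro ⟨g, hg⟩
  change evC a g = φ ⟨g, hg⟩
  refine Algebra.adjoin_induction (p := fun g hg => evC a g = φ ⟨g, hg⟩) ?_ ?_ ?_ ?_ hg
  · rintro _ ⟨h, rfl⟩
    exact evC_generic a h
  · intro r
    rw [AlgHom.commutes]
    exact (φ.commutes r).symm
  · intro x y hx hy h1 h2
    rw [map_add, h1, h2, ← map_add]; rfl
  · intro x y hx hy h1 h2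
    rw [map_mul, h1, h2, ← map_mul]; rfl

theorem main_thm (k : Type) [Field k] [IsAlgClosed k] [CharZero k] (n m : ℕ) (hn : 1 ≤ n) (hm : 2 ≤ m) :
    Set.BijOn (fun J : TwoSidedIdeal ↥(TMN k n m) => TwoSidedIdeal.comap (inclGT k n m) J)
      (SpecN n ↥(TMN k n m)) (SpecN n ↥(GMN k n m)) ∧
    ∀ J ∈ SpecN n ↥(TMN k n m),
      -- (a)
      (∃ (C : Type) (_ : Field C) (_ : Algebra k C)
          (ψ : ↥(TMN k n m) →ₐ[k] Matrix (Fin n) (Fin n) C),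
        (∀ p : ↥(TMN k n m), ψ p = 0 ↔ p ∈ J) ∧
        (∀ (p : MatPoly k n m) (hp : p ∈ TMN k n m) (htr : traceScalar k p ∈ TMN k n m),
          ψ ⟨traceScalar k p, htr⟩ =
            algebraMap C (Matrix (Fin n) (Fin n) C) (Matrix.trace (ψ ⟨p, hp⟩))) ∧
        ψ.range = Algebra.adjoin k
          ({x | ∃ p : ↥(GMN k n m), x = ψ ⟨(p : MatPoly k n m), GMN_le_TMN k n m p.2⟩} ∪
           {x | ∃ p : ↥(GMN k n m), x = algebraMap C (Matrix (Fin n) (Fin n) C)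
              (Matrix.trace (ψ ⟨(p : MatPoly k n m), GMN_le_TMN k n m p.2⟩))})) ∧
      -- (b)
      (∀ p : ↥(TMN k n m), p ∈ J →
        ∃ q : ↥(TMN k n m), q ∈ J ∧
          (q : MatPoly k n m) = traceScalar k (p : MatPoly k n m)) := by
  have : NeZero n := ⟨by omega⟩
  have hincl : ∀ g, inclGT k n m g = inclA k n m g := fun g => rfl
  refine ⟨⟨?_, ?_, ?_⟩, ?_⟩
  · intro J hJ
    obtain ⟨C, _, _, _, φ, hker, hfull⟩ := specN_rep (k := k) hn J hJ
    refine rep_specN (φ.comp (inclA k n m)) (full_restrict φ hfull) _ fun p => ?_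
    rw [TwoSidedIdeal.mem_comap, hincl, ← hker]; rfl
  · intro J₁ h₁ J₂ h₂ heq
    obtain ⟨C, _, _, _, φ, hker, hfull⟩ := specN_rep (k := k) hn J₁ h₁
    obtain ⟨D, _, _, _, ψ, hker', hfull'⟩ := specN_rep (k := k) hn J₂ h₂
    have h : ∀ g, φ (inclA k n m g) = 0 ↔ ψ (inclA k n m g) = 0 := by
      intro g
      rw [hker, hker', ← hincl, ← TwoSidedIdeal.mem_comap, ← TwoSidedIdeal.mem_comap]
      exact iff_of_eq (congrArg (g ∈ ·) heq)
    refine TwoSidedIdeal.ext fun p => ?_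
    rw [← hker, ← hker']
    exact ⟨inj_aux φ hfull ψ hfull' h p, inj_aux ψ hfull' φ hfull (fun g => (h g).symm) p⟩
  · intro P hP
    obtain ⟨C, _, _, _, φ, hker, hfull⟩ := specN_rep (k := k) hn P hP
    obtain ⟨ψ, hψ⟩ := extend_rep φ
    refine ⟨TwoSidedIdeal.ker ψ, ?_, ?_⟩
    · refine rep_specN ψ ?_ _ fun p => (by rw [TwoSidedIdeal.mem_ker])
      rw [eq_top_iff, ← hfull]
      apply Submodule.span_mono
      rintro _ ⟨g, rfl⟩
      exact ⟨_, hψ g⟩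
    · refine TwoSidedIdeal.ext fun g => ?_
      change g ∈ TwoSidedIdeal.comap _ _ ↔ _
      rw [TwoSidedIdeal.mem_comap, TwoSidedIdeal.mem_ker, hincl, hψ, hker]
  · intro J hJ
    obtain ⟨C, _, _, _, φ, hker, hfull⟩ := specN_rep (k := k) hn J hJ
    have htr := TMN_rep_trace φ hfull
    refine ⟨⟨C, inferInstance, inferInstance, φ, hker, fun p hp h => htr ⟨p, hp⟩, ?_⟩, ?_⟩
    · apply le_antisymm
      · rintro _ ⟨p, rfl⟩
        change φ p ∈ _
        induction p using TMN_induction with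
        | hG g => exact Algebra.subset_adjoin (Or.inl ⟨g, rfl⟩)
        | htr g h => exact Algebra.subset_adjoin (Or.inr ⟨g, htr (inclA k n m g)⟩)
        | hadd x y hx hy => rw [map_add]; exact add_mem hx hy
        | hmul x y hx hy => rw [map_mul]; exact mul_mem hx hy
      · apply Algebra.adjoin_le
        rintro _ (⟨g, rfl⟩ | ⟨g, rfl⟩)
        · exact ⟨_, rfl⟩
        · exact ⟨_, htr (inclA k n m g)⟩
    · intro p hp
      refine ⟨⟨_, traceScalar_mem k n m p p.2⟩, ?_, rfl⟩
      rw [← hker, htr, (hker p).2 hp, Matrix.trace_zero, map_zero]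
end

/-- **Statement 3** (Lemma lem:TraceRingofCoordRing:new).  The assignment
`J ↦ J ∩ G_{m,n}` defines a bijective correspondence between `Spec_n(T_{m,n})`
and `Spec_n(G_{m,n})`.  In addition, for any prime ideal `J ∈ Spec_n(T_{m,n})`:
(a) the natural projection `T_{m,n} → T_{m,n}/J` is trace-preserving, and
`T_{m,n}/J` is the trace ring of `G_{m,n}/(J ∩ G_{m,n})`; and
(b) `tr(p) ∈ J` for every `p ∈ J`.

Part (a) is rendered concretely: `T_{m,n}/J` (a prime PI-ring of PI-degree `n`)
admits a realization by `n×n` matrices over a field extension `C` of `k`, i.e. a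
`k`-algebra map `ψ : T_{m,n} → M_n(C)` with kernel exactly `J`; with respect to
such a realization the reduced trace is the matrix trace, "trace-preserving"
says `ψ(tr(p)·1) = tr(ψ(p))·1`, and "`T/J` is the trace ring of `G/(J ∩ G)`"
says that the image of `ψ` is generated as a `k`-algebra by the image of
`G_{m,n}` together with the traces of the image of `G_{m,n}`. -/
theorem trace_ring_spec_correspondence (n m : ℕ) (hn : 1 ≤ n) (hm : 2 ≤ m) :
    Set.BijOn (fun J : TwoSidedIdeal ↥(TMN k n m) => TwoSidedIdeal.comap (inclGT k n m) J)
      (SpecN n ↥(TMN k n m)) (SpecN n ↥(GMN k n m)) ∧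
    ∀ J ∈ SpecN n ↥(TMN k n m),
      -- (a)
      (∃ (C : Type) (_ : Field C) (_ : Algebra k C)
          (ψ : ↥(TMN k n m) →ₐ[k] Matrix (Fin n) (Fin n) C),
        (∀ p : ↥(TMN k n m), ψ p = 0 ↔ p ∈ J) ∧
        (∀ (p : MatPoly k n m) (hp : p ∈ TMN k n m) (htr : traceScalar k p ∈ TMN k n m),
          ψ ⟨traceScalar k p, htr⟩ =
            algebraMap C (Matrix (Fin n) (Fin n) C) (Matrix.trace (ψ ⟨p, hp⟩))) ∧
        ψ.range = Algebra.adjoin k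
          ({x | ∃ p : ↥(GMN k n m), x = ψ ⟨(p : MatPoly k n m), GMN_le_TMN k n m p.2⟩} ∪
           {x | ∃ p : ↥(GMN k n m), x = algebraMap C (Matrix (Fin n) (Fin n) C)
              (Matrix.trace (ψ ⟨(p : MatPoly k n m), GMN_le_TMN k n m p.2⟩))})) ∧
      -- (b)
      (∀ p : ↥(TMN k n m), p ∈ J →
        ∃ q : ↥(TMN k n m), q ∈ J ∧
          (q : MatPoly k n m) = traceScalar k (p : MatPoly k n m)) := by
  exact main_thm k n m hn hm

end
end

section
/- (a) Z(J) = Z(J ∩ G_{m,n}) for every ideal J of T_{m,n}. (b) If X ⊆ U_{m,n} is an n-variety, then X = Z(I(X)) = Z(I_T(X)). -/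
set_option linter.unusedSectionVars false

noncomputable section

universe u

-- Throughout, `k` is an algebraically closed base field of characteristic zero.
variable (k : Type) [Field k] [IsAlgClosed k] [CharZero k]

/-- `J` is a (two-sided) ideal of the subalgebra `A` of `M_n(k[x_{ij}^{(h)}])`,
viewed as a subset. -/
def IsIdealSetOf {n m : ℕ} (A : Subalgebra k (MatPoly k n m))
    (J : Set (MatPoly k n m)) : Prop :=
  J ⊆ (A : Set (MatPoly k n m)) ∧
  (0 : MatPoly k n m) ∈ J ∧
  (∀ p ∈ J, ∀ q ∈ J, p + q ∈ J) ∧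
  (∀ r ∈ A, ∀ p ∈ J, r * p ∈ J ∧ p * r ∈ J)

/-- The vanishing set of `X` in `A` (for `A = G_{m,n}` this is `I(X)`, for
`A = T_{m,n}` this is `I_T(X)`), viewed as a subset of `M_n(k[x_{ij}^{(h)}])`. -/
def vanishSet {n m : ℕ} (A : Subalgebra k (MatPoly k n m)) (X : Set (MTuple k n m)) :
    Set (MatPoly k n m) :=
  {p | p ∈ A ∧ ∀ a ∈ X, evalMat k a p = 0}


/-! ### Linear algebra: alternating maps and traces -/

namespace NVar

open Matrix in
lemma sum_det_update {R : Type*} [CommRing R] {ι : Type*} [Fintype ι] [DecidableEq ι]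
    (L A : Matrix ι ι R) :
    ∑ i, (A.updateCol i (fun j => (L * A) j i)).det = L.trace * A.det := by
  have h : ∀ i, (A.updateCol i (fun j => (L * A) j i)).det = (A.adjugate * (L * A)) i i := by
    intro i
    rw [← Matrix.cramer_apply, Matrix.cramer_eq_adjugate_mulVec]
    rfl
  simp_rw [h]
  change (A.adjugate * (L * A)).trace = _
  rw [Matrix.trace_mul_comm, Matrix.mul_assoc, Matrix.mul_adjugate]
  simp [mul_comm]

lemma sum_alt_update_scalar {R : Type*} [CommRing R] {M : Type*} [AddCommGroup M] [Module R M]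
    {ι : Type*} [Fintype ι] [DecidableEq ι] (e : Module.Basis ι R M)
    (f : M [⋀^ι]→ₗ[R] R) (L : M →ₗ[R] M) (x : ι → M) :
    ∑ i, f (Function.update x i (L (x i))) = LinearMap.trace R M L * f x := by
  rw [f.eq_smul_basis_det e]
  simp only [AlternatingMap.smul_apply, smul_eq_mul, ← Finset.mul_sum]
  rw [mul_left_comm]
  congr 1
  rw [LinearMap.trace_eq_matrix_trace R e, Module.Basis.det_apply, ← sum_det_update]
  refine Finset.sum_congr rfl fun i _ => ?_
  rw [Module.Basis.det_apply]
  congr 1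
  ext r s
  by_cases hs : s = i
  · subst hs
    simp only [Module.Basis.toMatrix_apply, Function.update_self, Matrix.updateCol_self,
      Matrix.mul_apply, LinearMap.toMatrix_apply]
    have h := e.sum_repr (x s)
    conv_lhs => rw [← h, map_sum, map_sum, Finsupp.finsetSum_apply]
    simp [mul_comm]
  · simp [Module.Basis.toMatrix_apply, hs]

lemma trace_mulLeft_matrix {R : Type*} [CommRing R] {n : ℕ} (g : Matrix (Fin n) (Fin n) R) :
    LinearMap.trace R _ (LinearMap.mulLeft R g) = (n : R) * g.trace := by
  rw [LinearMap.trace_eq_matrix_trace R (Matrix.stdBasis R (Fin n) (Fin n))]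
  simp only [Matrix.trace, Matrix.diag, LinearMap.toMatrix_apply, Fintype.sum_prod_type]
  have : ∀ i j : Fin n, ((Matrix.stdBasis R (Fin n) (Fin n)).repr
      (LinearMap.mulLeft R g (Matrix.stdBasis R (Fin n) (Fin n) (i, j)))) (i, j) = g i i := by
    intro i j
    rw [Matrix.stdBasis_eq_single]
    change (g * Matrix.single i j (1 : R)) i j = _
    simp
  simp only [this]
  simp [Finset.mul_sum]

lemma sum_alt_update {R : Type*} [CommRing R] {n : ℕ} {ι : Type*} [Fintype ι] [DecidableEq ι]
    (e : ι ≃ Fin n × Fin n)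
    (f : (Matrix (Fin n) (Fin n) R) [⋀^ι]→ₗ[R] (Matrix (Fin n) (Fin n) R))
    (g : Matrix (Fin n) (Fin n) R) (x : ι → Matrix (Fin n) (Fin n) R) :
    ∑ i, f (Function.update x i (g * x i)) = ((n : R) * g.trace) • f x := by
  ext r s
  have := sum_alt_update_scalar ((Matrix.stdBasis R (Fin n) (Fin n)).reindex e.symm)
    ((Matrix.entryLinearMap R R r s).compAlternatingMap f) (LinearMap.mulLeft R g) x
  rw [trace_mulLeft_matrix] at this
  simpa [Matrix.sum_apply] using this

/-- The Capelli polynomial, as an alternating map in the variables x. -/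
def cap {R : Type*} [CommRing R] {A : Type*} [Ring A] [Algebra R A] {N : ℕ}
    (y : Fin N → A) : A [⋀^Fin N]→ₗ[R] A :=
  MultilinearMap.alternatization
    ((MultilinearMap.mkPiAlgebraFin R N A).compLinearMap (fun i => LinearMap.mulRight R (y i)))

lemma cap_apply {R : Type*} [CommRing R] {A : Type*} [Ring A] [Algebra R A] {N : ℕ}
    (y x : Fin N → A) : cap (R := R) y x =
      ∑ σ : Equiv.Perm (Fin N), ((Equiv.Perm.sign σ : ℤ)) •
        (List.ofFn fun i => x (σ i) * y i).prod := by
  simp only [cap, MultilinearMap.alternatization_apply, MultilinearMap.domDomCongr_apply,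
    MultilinearMap.compLinearMap_apply, MultilinearMap.mkPiAlgebraFin_apply,
    LinearMap.mulRight_apply]
  rfl

open Classical in
lemma chain_prod {k : Type*} [CommRing k] {n : ℕ} : ∀ (N : ℕ) (c : Fin (N + 1) → Fin n)
    (u v q : Fin N → Fin n) (r : Fin n),
    Matrix.single r (c 0) (1 : k) * (List.ofFn fun t : Fin N =>
      Matrix.single (u t) (v t) (1 : k) * Matrix.single (q t) (c t.succ) (1 : k)).prod =
    if ∀ t, u t = c t.castSucc ∧ v t = q t then Matrix.single r (c (Fin.last N)) (1 : k) else 0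
  | 0, c, u, v, q, r => by simp
  | N + 1, c, u, v, q, r => by
    rw [List.ofFn_succ, List.prod_cons, ← mul_assoc, ← mul_assoc]
    by_cases h1 : u 0 = c 0
    · by_cases h2 : v 0 = q 0
      · rw [h1, h2, Matrix.single_mul_single_same, Matrix.single_mul_single_same]
        have := chain_prod (k := k) N (fun t => c t.succ) (fun t => u t.succ) (fun t => v t.succ)
          (fun t => q t.succ) r
        simp only [mul_one]
        rw [this]
        simp only [Fin.forall_fin_succ (n := N), Fin.castSucc_zero, h1, h2, true_and,
          Fin.succ_last, Fin.succ_castSucc]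
      · rw [mul_assoc (Matrix.single r (c 0) (1 : k)), Matrix.single_mul_single_of_ne _ _ _ _ h2,
          if_neg (fun h => h2 (h 0).2)]
        simp
    · rw [Matrix.single_mul_single_of_ne _ _ _ _ (Ne.symm h1), if_neg (fun h => h1 (h 0).1)]
      simp

variable {k}
variable {n m : ℕ}

lemma exists_eval {a : MTuple k n m} (ha : a ∈ genTuples k n m) (x : Matrix (Fin n) (Fin n) k) :
    ∃ g ∈ GMN k n m, evalMat k a g = x := by
  have h1 : (GMN k n m).map (evalMat k a) = ⊤ := by
    rw [GMN, AlgHom.map_adjoin, ← Set.range_comp]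
    have : (evalMat k a) ∘ (genericMatrix k n m) = a := by
      funext h
      ext i j
      simp [evalMat, genericMatrix, polyEval]
    rw [this]
    exact ha
  have : x ∈ (GMN k n m).map (evalMat k a) := by rw [h1]; trivial
  simpa using this

lemma evalMat_generic (a : MTuple k n m) (h : Fin m) :
    evalMat k a (genericMatrix k n m h) = a h := by
  ext i j
  simp [evalMat, genericMatrix, polyEval]

/-- Values of Capelli polynomials on `G`. -/
def capSet (k : Type) [Field k] (n m : ℕ) : Set (MatPoly k n m) :=
  {d | ∃ (y0 : MatPoly k n m) (y x : Fin (n * n) → MatPoly k n m), y0 ∈ GMN k n m ∧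
    (∀ i, y i ∈ GMN k n m) ∧ (∀ i, x i ∈ GMN k n m) ∧
    d = y0 * cap (R := PolyRing k n m) y x}

lemma capSpan_le : Submodule.span k (capSet k n m) ≤ Subalgebra.toSubmodule (GMN k n m) := by
  rw [Submodule.span_le]
  rintro _ ⟨y0, y, x, h0, hy, hx, rfl⟩
  rw [cap_apply]
  change _ ∈ GMN k n m
  refine mul_mem h0 (sum_mem fun σ _ => zsmul_mem (list_prod_mem ?_) _)
  intro z hz
  rw [List.mem_ofFn] at hz
  obtain ⟨i, rfl⟩ := hz
  exact mul_mem (hx _) (hy _)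

lemma TMN_mul_capSpan (hn : 1 ≤ n) {t : MatPoly k n m} (ht : t ∈ TMN k n m) :
    ∀ d ∈ Submodule.span k (capSet k n m), t * d ∈ Submodule.span k (capSet k n m) := by
  unfold TMN at ht
  induction ht using Algebra.adjoin_induction with
  | mem t ht =>
    intro d hd
    induction hd using Submodule.span_induction with
    | mem d hd =>
      obtain ⟨y0, y, x, h0, hy, hx, rfl⟩ := hd
      rcases ht with ht | ⟨g, hg, rfl⟩
      · rw [← mul_assoc]
        exact Submodule.subset_span ⟨_, y, x, mul_mem ht h0, hy, hx, rfl⟩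
      · have key := sum_alt_update (finProdFinEquiv (m := n) (n := n)).symm
          (cap (R := PolyRing k n m) y) g x
        have e1 : traceScalar k g * (y0 * cap (R := PolyRing k n m) y x) =
            (n : k)⁻¹ • ∑ i, y0 * cap (R := PolyRing k n m) y (Function.update x i (g * x i)) := by
          have hn' : (n : k) ≠ 0 := by
            exact_mod_cast (by omega : n ≠ 0)
          rw [← Finset.mul_sum, key, eq_inv_smul_iff₀ hn', traceScalar, ← Algebra.smul_def,
            mul_smul_comm, mul_smul, Nat.cast_smul_eq_nsmul, Nat.cast_smul_eq_nsmul]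
        rw [e1]
        refine Submodule.smul_mem _ _ (sum_mem fun i _ => Submodule.subset_span
          ⟨y0, y, _, h0, hy, ?_, rfl⟩)
        intro j
        by_cases hj : j = i
        · subst hj
          simpa using mul_mem hg (hx j)
        · simpa [hj] using hx j
    | zero => simp
    | add u v _ _ hu hv => rw [mul_add]; exact add_mem hu hv
    | smul c u _ hu => rw [mul_smul_comm]; exact Submodule.smul_mem _ _ hu
  | algebraMap r =>
    intro d hd
    rw [← Algebra.smul_def]
    exact Submodule.smul_mem _ _ hd
  | add s t _ _ hs ht => intro d hd; rw [add_mul]; exact add_mem (hs d hd) (ht d hd)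
  | mul s t _ _ hs ht => intro d hd; rw [mul_assoc]; exact hs _ (ht d hd)

lemma exists_cap {a : MTuple k n m} (ha : a ∈ genTuples k n m) (r s : Fin n) :
    ∃ d ∈ capSet k n m, evalMat k a d = Matrix.single r s 1 := by
  classical
  choose G hG hGa using fun x => exists_eval ha x
  let e : Fin (n * n) ≃ Fin n × Fin n := finProdFinEquiv.symm
  let c : Fin (n * n + 1) → Fin n := Fin.snoc (α := fun _ => Fin n) (fun t => (e t).1) s
  refine ⟨G (Matrix.single r (c 0) 1) * cap (R := PolyRing k n m)
    (fun t => G (Matrix.single (e t).2 (c t.succ) 1))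
    (fun t => G (Matrix.single (e t).1 (e t).2 1)),
    ⟨_, _, _, hG _, fun _ => hG _, fun _ => hG _, rfl⟩, ?_⟩
  rw [cap_apply, map_mul, map_sum, hGa, Finset.mul_sum]
  simp only [map_zsmul, map_list_prod, List.map_ofFn, mul_smul_comm, Function.comp_def, map_mul, hGa]
  have h : ∀ σ : Equiv.Perm (Fin (n * n)), (∀ t, (e (σ t)).1 = c t.castSucc ∧
      (e (σ t)).2 = (e t).2) ↔ σ = 1 := by
    intro σ
    constructor
    · intro h
      ext1 t
      apply e.injective
      have := h t
      simp only [c, Fin.snoc_castSucc] at this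
      exact Prod.ext this.1 this.2
    · rintro rfl t
      simp [c]
  simp only [chain_prod, h]
  simp [c]

theorem part_a (hn : 1 ≤ n) (J : Set (MatPoly k n m)) (hJ : IsIdealSetOf k (TMN k n m) J) :
    zeroLocus k J = zeroLocus k (J ∩ (GMN k n m : Set (MatPoly k n m))) := by
  apply Set.Subset.antisymm
  · exact fun a ha => ⟨ha.1, fun p hp => ha.2 p hp.1⟩
  · intro a ha
    refine ⟨ha.1, fun p hp => ?_⟩
    by_contra hne
    obtain ⟨i, r, hir⟩ : ∃ i r, evalMat k a p i r ≠ 0 := by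
      by_contra hcon
      push Not at hcon
      exact hne (by ext i r; exact hcon i r)
    obtain ⟨d, hd, hda⟩ := exists_cap ha.1 r r
    have hdG := capSpan_le (Submodule.subset_span hd)
    have h1 : p * d ∈ J := (hJ.2.2.2 d (GMN_le_TMN k n m hdG) p hp).2
    have h2 : p * d ∈ GMN k n m :=
      capSpan_le (TMN_mul_capSpan hn (hJ.1 hp) d (Submodule.subset_span hd))
    have h3 := ha.2 _ ⟨h1, h2⟩
    rw [map_mul, hda] at h3
    have := congrFun (congrFun h3 i) r
    simp at this
    exact hir this

/-! ### Traces of the trace ring; coefficients of the characteristic polynomial -/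

/-- The scalars contained in the trace ring. -/
def traceC (k : Type) [Field k] (n m : ℕ) : Subalgebra k (PolyRing k n m) :=
  (TMN k n m).comap (IsScalarTower.toAlgHom k (PolyRing k n m) (MatPoly k n m))

lemma mem_traceC {c : PolyRing k n m} :
    c ∈ traceC k n m ↔ algebraMap (PolyRing k n m) (MatPoly k n m) c ∈ TMN k n m := Iff.rfl

lemma smul_mem_TMN {c : PolyRing k n m} (hc : c ∈ traceC k n m) {t : MatPoly k n m}
    (ht : t ∈ TMN k n m) : c • t ∈ TMN k n m := by
  rw [Algebra.smul_def]
  exact mul_mem hc ht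

lemma trace_GMN_mem {g : MatPoly k n m} (hg : g ∈ GMN k n m) : g.trace ∈ traceC k n m :=
  Algebra.subset_adjoin (Or.inr ⟨g, hg, rfl⟩)

lemma trace_mem_aux {t : MatPoly k n m} (ht : t ∈ TMN k n m) :
    ∀ x : MatPoly k n m, (∀ g ∈ GMN k n m, (x * g).trace ∈ traceC k n m) →
      ∀ g ∈ GMN k n m, (x * t * g).trace ∈ traceC k n m := by
  unfold TMN at ht
  induction ht using Algebra.adjoin_induction with
  | mem t ht =>
    intro x hx g hg
    rcases ht with ht | ⟨g', hg', rfl⟩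
    · rw [mul_assoc]
      exact hx _ (mul_mem ht hg)
    · rw [traceScalar, ← Algebra.commutes, ← Algebra.smul_def, smul_mul_assoc, Matrix.trace_smul,
        smul_eq_mul]
      exact mul_mem (trace_GMN_mem hg') (hx g hg)
  | algebraMap r =>
    intro x hx g hg
    rw [← Algebra.commutes, ← Algebra.smul_def, smul_mul_assoc, Matrix.trace_smul]
    exact Subalgebra.smul_mem _ (hx g hg) r
  | add s t _ _ hs ht =>
    intro x hx g hg
    rw [mul_add, add_mul, Matrix.trace_add]
    exact add_mem (hs x hx g hg) (ht x hx g hg)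
  | mul s t _ _ hs ht =>
    intro x hx g hg
    rw [← mul_assoc]
    exact ht _ (hs x hx) g hg

lemma trace_mem {t : MatPoly k n m} (ht : t ∈ TMN k n m) : t.trace ∈ traceC k n m := by
  have := trace_mem_aux ht 1 (fun g hg => by simpa using trace_GMN_mem hg) 1 (one_mem _)
  simpa using this

open Polynomial in
lemma derivative_det {R : Type*} [CommRing R] {ι : Type*} [Fintype ι] [DecidableEq ι]
    (M : Matrix ι ι R[X]) :
    derivative M.det = (M.adjugate * M.map derivative).trace := by
  have h : ∀ i, (M.updateCol i (fun j => derivative (M j i))).det =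
      (M.adjugate * M.map derivative) i i := by
    intro i
    rw [← Matrix.cramer_apply, Matrix.cramer_eq_adjugate_mulVec]
    rfl
  simp only [Matrix.trace, Matrix.diag, ← h]
  simp only [Matrix.det_apply, derivative_sum]
  rw [Finset.sum_comm]
  refine Finset.sum_congr rfl fun σ _ => ?_
  rw [← Finset.smul_sum]
  have e1 : ∀ (s : ℤˣ) (p : R[X]), derivative (s • p) = s • derivative p := by
    intro s p
    rcases Int.units_eq_one_or s with rfl | rfl <;> simp
  rw [e1]
  congr 1
  rw [derivative_prod_finset]
  refine Finset.sum_congr rfl fun i _ => ?_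
  rw [← Finset.prod_erase_mul _ _ (Finset.mem_univ i)]
  simp only [Matrix.updateCol_self]
  congr 1
  refine Finset.prod_congr rfl fun j hj => ?_
  rw [Matrix.updateCol_ne (Finset.ne_of_mem_erase hj)]

open Polynomial in
lemma charmatrix_derivative {R : Type*} [CommRing R] {ι : Type*} [Fintype ι] [DecidableEq ι]
    (M : Matrix ι ι R) : M.charmatrix.map derivative = 1 := by
  ext1 i j
  by_cases h : i = j
  · subst h; simp [Matrix.charmatrix_apply_eq]
  · simp [h]

open Polynomial in
lemma adj_coeff_mem {y : MatPoly k n m} (hy : y ∈ TMN k n m) :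
    ∀ i, (y.charmatrix.adjugate.map fun q => q.coeff i) ∈ TMN k n m := by
  set Z := y.charmatrix.adjugate with hZ
  obtain ⟨M, hM⟩ : ∃ M : ℕ, ∀ i ≥ M, (Z.map fun q => q.coeff i) = 0 := by
    refine ⟨(Finset.univ.sup fun r => Finset.univ.sup fun s => (Z r s).natDegree) + 1, ?_⟩
    intro i hi
    ext1 r s
    rw [Matrix.map_apply, Matrix.zero_apply]
    apply coeff_eq_zero_of_natDegree_lt
    have h1 : (Z r s).natDegree ≤ Finset.univ.sup fun s => (Z r s).natDegree :=
      Finset.le_sup (f := fun s => (Z r s).natDegree) (Finset.mem_univ s)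
    have h2 := Finset.le_sup (f := fun r => Finset.univ.sup fun s => (Z r s).natDegree)
      (Finset.mem_univ r)
    exact Nat.lt_of_le_of_lt (h1.trans h2) (Nat.lt_of_succ_le hi)
  have hrec : ∀ i, (Z.map fun q => q.coeff i) =
      y * (Z.map fun q => q.coeff (i + 1)) +
        algebraMap (PolyRing k n m) (MatPoly k n m) (y.charpoly.coeff (i + 1)) := by
    intro i
    have h := Matrix.mul_adjugate y.charmatrix
    rw [← hZ] at h
    ext1 r s
    have h2 := congrArg (fun q => q.coeff (i + 1)) (congrFun (congrFun h r) s)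
    simp only [Matrix.charmatrix, Matrix.sub_mul, Matrix.sub_apply] at h2
    rw [coeff_sub] at h2
    have h3 : (((Matrix.scalar (Fin n)) X : Matrix (Fin n) (Fin n) (PolyRing k n m)[X]) * Z) r s
        = X * Z r s := by
      simp [Matrix.scalar_apply]
    have h4 : ((C.mapMatrix y * Z) r s).coeff (i + 1) =
        (y * Z.map fun q => q.coeff (i + 1)) r s := by
      simp [Matrix.mul_apply, finsetSum_coeff]
    rw [h3, h4, coeff_X_mul] at h2
    have h5 : ((Matrix.det (Matrix.scalar (Fin n) X - C.mapMatrix y) •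
        (1 : Matrix (Fin n) (Fin n) (PolyRing k n m)[X])) r s).coeff (i + 1) =
        algebraMap (PolyRing k n m) (MatPoly k n m) (y.charpoly.coeff (i + 1)) r s := by
      by_cases hrs : r = s
      · subst hrs
        simp [Matrix.algebraMap_matrix_apply, Matrix.charpoly, Matrix.charmatrix]
      · simp [Matrix.algebraMap_matrix_apply, hrs]
    rw [h5] at h2
    rw [Matrix.add_apply, ← h2, Matrix.map_apply]
    ring
  have htr : ∀ i, (Z.map fun q => q.coeff i).trace = y.charpoly.coeff (i + 1) * ((i : ℕ) + 1) := by
    intro i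
    have h := derivative_det y.charmatrix
    rw [charmatrix_derivative, mul_one] at h
    have h2 := congrArg (fun q => q.coeff i) h
    simp only [coeff_derivative] at h2
    rw [Matrix.charpoly, h2]
    simp [Matrix.trace, finsetSum_coeff]
    rfl
  have hstep : ∀ i, (Z.map fun q => q.coeff (i + 1)) ∈ TMN k n m →
      (Z.map fun q => q.coeff i) ∈ TMN k n m := by
    intro i hi
    have hc : y.charpoly.coeff (i + 1) ∈ traceC k n m := by
      by_cases hin : i + 1 = n
      · have h1 := y.charpoly_monic
        have h2 := y.charpoly_natDegree_eq_dim
        rw [Fintype.card_fin] at h2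
        rw [hin]
        rw [Monic, leadingCoeff, h2] at h1
        rw [h1]
        exact one_mem _
      · have h1 := congrArg Matrix.trace (hrec i)
        rw [htr, Matrix.trace_add] at h1
        have h2 : (algebraMap (PolyRing k n m) (MatPoly k n m)
            (y.charpoly.coeff (i + 1))).trace = (n : PolyRing k n m) * y.charpoly.coeff (i + 1) := by
          simp [Matrix.trace, Matrix.algebraMap_matrix_apply]
        rw [h2] at h1
        have hne : ((i : k) + 1 - n) ≠ 0 := by
          intro h0
          apply hin
          have : ((i + 1 : ℕ) : k) = (n : k) := by push_cast; linear_combination h0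
          exact_mod_cast this
        have h3 : y.charpoly.coeff (i + 1) = ((i : k) + 1 - n)⁻¹ •
            (y * (Z.map fun q => q.coeff (i + 1))).trace := by
          rw [eq_inv_smul_iff₀ hne, Algebra.smul_def]
          simp only [map_sub, map_add, map_natCast, map_one]
          linear_combination h1
        rw [h3]
        exact Subalgebra.smul_mem _ (trace_mem (mul_mem hy hi)) _
    rw [hrec]
    exact add_mem (mul_mem hy hi) hc
  have hall : ∀ j i, i + j ≥ M → (Z.map fun q => q.coeff i) ∈ TMN k n m := by
    intro j
    induction j with
    | zero => intro i hi; rw [hM i hi]; exact zero_mem _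
    | succ j ih => intro i hi; exact hstep i (ih (i + 1) (by omega))
  exact fun i => hall M i (by omega)

open Polynomial in
/-- Polynomials with coefficients in `traceC`. -/
def polyC (k : Type) [Field k] (n m : ℕ) : Subalgebra k (Polynomial (PolyRing k n m)) where
  carrier := {q | ∀ i, q.coeff i ∈ traceC k n m}
  mul_mem' {p q} hp hq i := by
    rw [coeff_mul]
    exact sum_mem fun x _ => mul_mem (hp _) (hq _)
  add_mem' {p q} hp hq i := by
    rw [coeff_add]
    exact add_mem (hp i) (hq i)
  algebraMap_mem' r i := by
    rw [Polynomial.algebraMap_apply, coeff_C]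
    split_ifs
    · exact Subalgebra.algebraMap_mem _ r
    · exact zero_mem _

open Polynomial in
lemma aeval_mem_TMN {y : MatPoly k n m} (hy : y ∈ TMN k n m) {q : (PolyRing k n m)[X]}
    (hq : q ∈ polyC k n m) : aeval y q ∈ TMN k n m := by
  rw [aeval_eq_sum_range]
  exact sum_mem fun i _ => smul_mem_TMN (hq i) (pow_mem hy i)

/-- `tr (w · adj(λ - y))` as a polynomial in `λ`. -/
def trZ (y w : MatPoly k n m) : Polynomial (PolyRing k n m) :=
  (w.map Polynomial.C * y.charmatrix.adjugate).trace

open Polynomial in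
lemma trZ_mem {y w : MatPoly k n m} (hy : y ∈ TMN k n m) (hw : w ∈ TMN k n m) :
    trZ y w ∈ polyC k n m := by
  intro i
  have : (trZ y w).coeff i = (w * (y.charmatrix.adjugate.map fun q => q.coeff i)).trace := by
    simp [trZ, Matrix.trace, Matrix.mul_apply, finsetSum_coeff]
  rw [this]
  exact trace_mem (mul_mem hw (adj_coeff_mem hy i))

lemma det_mem_of {R A : Type*} [CommRing R] [CommRing A] [Algebra R A] (S : Subalgebra R A)
    {ι : Type*} [Fintype ι] [DecidableEq ι] (M : Matrix ι ι A) (h : ∀ i j, M i j ∈ S) :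
    M.det ∈ S := by
  rw [Matrix.det_apply']
  exact sum_mem fun σ _ => mul_mem (intCast_mem _ _) (prod_mem fun i _ => h _ _)

lemma adj_mem_of {R A : Type*} [CommRing R] [CommRing A] [Algebra R A] (S : Subalgebra R A)
    {ι : Type*} [Fintype ι] [DecidableEq ι] (M : Matrix ι ι A) (h : ∀ i j, M i j ∈ S) (i j : ι) :
    M.adjugate i j ∈ S := by
  rw [Matrix.adjugate_apply]
  apply det_mem_of
  intro r s
  rw [Matrix.updateRow_apply]
  split_ifs
  · rw [Pi.single_apply]
    split_ifs
    · exact one_mem _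
    · exact zero_mem _
  · exact h r s

/-! ### Separating points from `n`-varieties -/

lemma adj_minor {R : Type*} [CommRing R] {ι : Type*} [Fintype ι] [DecidableEq ι]
    (M : Matrix ι ι R) (h : M.det = 0) (i j p q : ι) :
    M.adjugate i j * M.adjugate p q = M.adjugate p j * M.adjugate i q := by
  -- replace row `j` of `M` by the `i`-th unit vector
  set M' := M.updateRow j (Pi.single i 1) with hM'
  have hdet : M'.det = M.adjugate i j := (Matrix.adjugate_apply M i j).symm
  have hcol : ∀ p, M'.adjugate p j = M.adjugate p j := by
    intro p
    rw [Matrix.adjugate_apply, Matrix.adjugate_apply, hM', Matrix.updateRow_idem]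
  let v : ι → R := fun p => M.adjugate p q
  have hMv : Matrix.mulVec M v = 0 := by
    have := Matrix.mul_adjugate M
    rw [h, zero_smul] at this
    ext r
    exact congrFun (congrFun this r) q
  have hM'v : Matrix.mulVec M' v = Pi.single j (v i) := by
    ext r
    by_cases hr : r = j
    · subst hr
      simp [hM', Matrix.mulVec, dotProduct, Pi.single_apply]
    · have := congrFun hMv r
      simp only [Matrix.mulVec, dotProduct] at this
      simp [hM', Matrix.mulVec, dotProduct, hr]
      simpa using this
  have h1 := congrArg (Matrix.mulVec M'.adjugate) hM'v
  rw [Matrix.mulVec_mulVec, Matrix.adjugate_mul, Matrix.smul_mulVec, Matrix.one_mulVec] at h1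
  have h2 := congrFun h1 p
  simp only [Pi.smul_apply, smul_eq_mul, Matrix.mulVec_single, hdet] at h2
  rw [show M.adjugate p q = v p from rfl, h2]
  simp [hcol, v]

lemma adj_rank_one {K : Type*} [Field K] {ι : Type*} [Fintype ι] [DecidableEq ι]
    (M : Matrix ι ι K) (h : M.det = 0) : ∃ v u : ι → K, M.adjugate = Matrix.vecMulVec v u := by
  by_cases h0 : M.adjugate = 0
  · exact ⟨0, 0, by rw [h0]; ext; simp [Matrix.vecMulVec_apply]⟩
  · obtain ⟨i0, j0, hij⟩ : ∃ i j, M.adjugate i j ≠ 0 := by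
      by_contra hcon
      push Not at hcon
      exact h0 (by ext i r; exact hcon i r)
    refine ⟨fun i => M.adjugate i j0, fun l => M.adjugate i0 l / M.adjugate i0 j0, ?_⟩
    ext p q
    rw [Matrix.vecMulVec_apply, ← mul_div_assoc, eq_div_iff hij, ← adj_minor M h i0 j0 p q]
    ring

/-- Homogenization of a polynomial. -/
def homog {ι : Type*} (f : MvPolynomial ι k) : MvPolynomial (Option ι) k :=
  ∑ α ∈ f.support, MvPolynomial.C (f.coeff α) *
    (MvPolynomial.X none ^ (f.totalDegree - α.sum fun _ e => e) *
      α.prod fun i e => MvPolynomial.X (some i) ^ e)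

lemma homog_aeval {ι : Type*} (f : MvPolynomial ι k) (d : k) (hd : d ≠ 0) (x : ι → k) :
    MvPolynomial.aeval (fun o : Option ι => o.elim d x) (homog f) =
      d ^ f.totalDegree * MvPolynomial.aeval (fun i => d⁻¹ * x i) f := by
  have e : MvPolynomial.aeval (fun i => d⁻¹ * x i) f = ∑ α ∈ f.support,
      MvPolynomial.aeval (fun i => d⁻¹ * x i) (MvPolynomial.monomial α (f.coeff α)) := by
    conv_lhs => rw [f.as_sum]
    rw [map_sum]
  rw [e, homog, map_sum, Finset.mul_sum]
  refine Finset.sum_congr rfl fun α hα => ?_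
  have hle : (α.sum fun _ e => e) ≤ f.totalDegree := MvPolynomial.le_totalDegree hα
  rw [MvPolynomial.aeval_monomial]
  simp only [map_mul, map_pow, MvPolynomial.aeval_X, MvPolynomial.aeval_C, Option.elim_none,
    Finsupp.prod, map_prod, Option.elim_some, mul_pow, Finset.prod_mul_distrib,
    Finset.prod_pow_eq_pow_sum]
  have : d ^ f.totalDegree = d ^ (f.totalDegree - α.sum fun _ e => e) *
      d ^ (α.sum fun _ e => e) := by
    rw [← pow_add, Nat.sub_add_cancel hle]
  rw [this, Finsupp.sum]
  have h2 : d ^ (∑ a ∈ α.support, α a) * d⁻¹ ^ (∑ a ∈ α.support, α a) = 1 := by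
    rw [← mul_pow, mul_inv_cancel₀ hd, one_pow]
  linear_combination (- (algebraMap k k (MvPolynomial.coeff α f)) *
    d ^ (f.totalDegree - ∑ a ∈ α.support, α a) * ∏ a ∈ α.support, x a ^ α a) * h2

lemma mv_aeval_mem {ι A : Type*} [CommRing A] [Algebra k A] (S : Subalgebra k A) (x : ι → A)
    (hx : ∀ i, x i ∈ S) (f : MvPolynomial ι k) : MvPolynomial.aeval x f ∈ S := by
  have : MvPolynomial.aeval x f ∈ Algebra.adjoin k (Set.range x) := by
    rw [Algebra.adjoin_range_eq_range_aeval]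
    exact ⟨f, rfl⟩
  refine (Algebra.adjoin_le ?_) this
  rintro _ ⟨i, rfl⟩
  exact hx i

section construction

variable (y : MatPoly k n m) (w w' : Fin n → MatPoly k n m) (f : PolyRing k n m)

/-- The matrix `A(λ)`. -/
def matA : Matrix (Fin n) (Fin n) (Polynomial (PolyRing k n m)) :=
  Matrix.of fun i j => trZ y (w' i * w j)

/-- The matrices `B_h(λ)`. -/
def matB (h : Fin m) : Matrix (Fin n) (Fin n) (Polynomial (PolyRing k n m)) :=
  Matrix.of fun i j => trZ y (w' i * genericMatrix k n m h * w j)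

/-- The separating polynomial. -/
def sepPoly : Polynomial (PolyRing k n m) :=
  (matA y w w').det * MvPolynomial.aeval
    (fun o : Option (MIdx n m) => o.elim (matA y w w').det
      (fun x => ((matA y w w').adjugate * matB y w w' x.1) x.2.1 x.2.2)) (homog f)

lemma sepPoly_mem (hy : y ∈ GMN k n m) (hw : ∀ i, w i ∈ GMN k n m) (hw' : ∀ i, w' i ∈ GMN k n m) :
    sepPoly y w w' f ∈ polyC k n m := by
  have hA : ∀ i j, matA y w w' i j ∈ polyC k n m := fun i j =>
    trZ_mem (GMN_le_TMN k n m hy) (GMN_le_TMN k n m (mul_mem (hw' i) (hw j)))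
  have hB : ∀ h i j, matB y w w' h i j ∈ polyC k n m := fun h i j =>
    trZ_mem (GMN_le_TMN k n m hy) (GMN_le_TMN k n m (mul_mem (mul_mem (hw' i)
      (Algebra.subset_adjoin ⟨h, rfl⟩)) (hw j)))
  refine mul_mem (det_mem_of _ _ hA) (mv_aeval_mem _ _ ?_ _)
  rintro (_ | x)
  · exact det_mem_of _ _ hA
  · simp only [Option.elim_some, Matrix.mul_apply]
    exact sum_mem fun j _ => mul_mem (adj_mem_of _ _ hA _ _) (hB _ _ _)

/-- Evaluation at `(b, λ)`. -/
def evalAt (b : MTuple k n m) (l : k) : Polynomial (PolyRing k n m) →ₐ[k] k :=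
  (Polynomial.aeval l).comp (Polynomial.mapAlgHom (polyEval k b))

lemma evalAt_apply (b : MTuple k n m) (l : k) (q : Polynomial (PolyRing k n m)) :
    evalAt b l q = (q.map (polyEval k b : PolyRing k n m →+* k)).eval l := by
  rw [evalAt, AlgHom.comp_apply, Polynomial.coe_aeval_eq_eval]
  rfl

lemma evalAt_trZ (b : MTuple k n m) (l : k) (v : MatPoly k n m) :
    evalAt b l (trZ y v) =
      (evalMat k b v * (Matrix.scalar (Fin n) l - evalMat k b y).adjugate).trace := by
  have h1 : (evalAt b l).mapMatrix (v.map Polynomial.C) = evalMat k b v := by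
    ext i j
    simp [evalAt, evalMat]
  have h2 : (evalAt b l).mapMatrix y.charmatrix =
      Matrix.scalar (Fin n) l - evalMat k b y := by
    ext i j
    by_cases hij : i = j
    · subst hij
      simp [evalAt, evalMat, Matrix.charmatrix_apply_eq]
    · simp [evalAt, evalMat, Matrix.charmatrix_apply_ne _ _ _ hij, hij]
  rw [trZ, ← h2, ← AlgHom.map_adjugate, ← h1, ← map_mul]
  simp only [Matrix.trace, Matrix.diag, map_sum]
  rfl

lemma evalAt_sepPoly (b : MTuple k n m) (l : k) :
    evalAt b l (sepPoly y w w' f) =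
      ((evalAt b l).mapMatrix (matA y w w')).det * MvPolynomial.aeval
        (fun o : Option (MIdx n m) => o.elim ((evalAt b l).mapMatrix (matA y w w')).det
          (fun x => (((evalAt b l).mapMatrix (matA y w w')).adjugate *
            (evalAt b l).mapMatrix (matB y w w' x.1)) x.2.1 x.2.2)) (homog f) := by
  rw [sepPoly, map_mul, MvPolynomial.comp_aeval_apply, AlgHom.map_det]
  congr 3
  funext o
  rcases o with _ | x
  · simp [AlgHom.map_det]
  · have h : (evalAt b l).mapMatrix ((matA y w w').adjugate * matB y w w' x.1) =
        ((evalAt b l).mapMatrix (matA y w w')).adjugate *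
            (evalAt b l).mapMatrix (matB y w w' x.1) := by
      rw [map_mul, AlgHom.map_adjugate]
    exact congrFun (congrFun h x.2.1) x.2.2

end construction

lemma sep_vanish {X : Set (MTuple k n m)}
    (hX : ∀ g : GL (Fin n) k, ∀ a ∈ X, conjAct k g a ∈ X)
    (y : MatPoly k n m) (w w' : Fin n → MatPoly k n m) (f : PolyRing k n m)
    (hf : ∀ b ∈ X, polyEval k b f = 0) {b : MTuple k n m} (hb : b ∈ X) (l : k)
    (hl : (Matrix.scalar (Fin n) l - evalMat k b y).det = 0) :
    evalAt b l (sepPoly y w w' f) = 0 := by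
  obtain ⟨v, u, hvu⟩ := adj_rank_one _ hl
  rw [evalAt_sepPoly]
  set A := (evalAt b l).mapMatrix (matA y w w') with hA
  by_cases hd : A.det = 0
  · rw [hd, zero_mul]
  let Q : Matrix (Fin n) (Fin n) k := Matrix.of fun i j => Matrix.vecMul u (evalMat k b (w' i)) j
  let P : Matrix (Fin n) (Fin n) k := Matrix.of fun i j => Matrix.mulVec (evalMat k b (w j)) v i
  have tr1 : ∀ (M : Matrix (Fin n) (Fin n) k) (i j : Fin n),
      (evalMat k b (w' i) * M * evalMat k b (w j) * Matrix.vecMulVec v u).trace =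
        (Q * M * P) i j := by
    intro M i j
    rw [Matrix.mul_vecMulVec, Matrix.trace_vecMulVec, ← Matrix.mulVec_mulVec,
      ← Matrix.mulVec_mulVec, dotProduct_comm, Matrix.dotProduct_mulVec, Matrix.dotProduct_mulVec]
    simp only [Matrix.mul_apply', Q, P]
    rfl
  have hAQP : A = Q * P := by
    ext i j
    have h1 : A i j = evalAt b l (trZ y (w' i * w j)) := rfl
    rw [h1, evalAt_trZ, hvu, map_mul]
    simpa using tr1 1 i j
  have hB : ∀ h, (evalAt b l).mapMatrix (matB y w w' h) = Q * b h * P := by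
    intro h
    ext i j
    have h1 : (evalAt b l).mapMatrix (matB y w w' h) i j =
      evalAt b l (trZ y (w' i * genericMatrix k n m h * w j)) := rfl
    rw [h1, evalAt_trZ, hvu, map_mul, map_mul, evalMat_generic]
    exact tr1 _ i j
  rw [homog_aeval _ _ hd]
  have hQ : IsUnit Q.det := by
    rw [isUnit_iff_ne_zero]; intro h0; apply hd; rw [hAQP, Matrix.det_mul, h0, zero_mul]
  have hP : IsUnit P.det := by
    rw [isUnit_iff_ne_zero]; intro h0; apply hd; rw [hAQP, Matrix.det_mul, h0, mul_zero]
  let g : GL (Fin n) k := (Matrix.nonsingInvUnit P hP)⁻¹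
  have h2 : MvPolynomial.aeval (fun x : MIdx n m => A.det⁻¹ * (A.adjugate *
      (evalAt b l).mapMatrix (matB y w w' x.1)) x.2.1 x.2.2) f = polyEval k (conjAct k g b) f := by
    rw [polyEval]
    congr 2
    funext x
    have e1 : A⁻¹ = A.det⁻¹ • A.adjugate := by rw [Matrix.inv_def, Ring.inverse_eq_inv']
    have e2 : A.det⁻¹ * (A.adjugate * (evalAt b l).mapMatrix (matB y w w' x.1)) x.2.1 x.2.2 =
        (A⁻¹ * (evalAt b l).mapMatrix (matB y w w' x.1)) x.2.1 x.2.2 := by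
      rw [e1, Matrix.smul_mul]; rfl
    rw [e2, hB, hAQP, Matrix.mul_inv_rev]
    have e3 : P⁻¹ * Q⁻¹ * (Q * b x.1 * P) = P⁻¹ * b x.1 * P := by
      rw [Matrix.mul_assoc, Matrix.mul_assoc Q, Matrix.nonsing_inv_mul_cancel_left _ _ hQ,
        Matrix.mul_assoc]
    rw [e3]
    have e4 : (g : Matrix (Fin n) (Fin n) k) = P⁻¹ := by
      rfl
    have e5 : ((g⁻¹ : GL (Fin n) k) : Matrix (Fin n) (Fin n) k) = P := by
      simp [g, Matrix.nonsingInvUnit]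
    rw [conjAct, e4, e5]
  rw [h2, hf _ (hX g b hb)]
  simp

open Polynomial in
lemma nilp (Y : Matrix (Fin n) (Fin n) k) (q : k[X])
    (h : ∀ l, (Matrix.scalar (Fin n) l - Y).det = 0 → q.eval l = 0) : (aeval Y q) ^ n = 0 := by
  have hs := (IsAlgClosed.splits Y.charpoly)
  have h1 := hs.eq_prod_roots_of_monic Y.charpoly_monic
  have h2 : Y.charpoly ∣ q ^ n := by
    have hcard : Y.charpoly.roots.card = n := by
      rw [← hs.natDegree_eq_card_roots, Y.charpoly_natDegree_eq_dim, Fintype.card_fin]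
    have h3 : (Multiset.map (fun x => X - C x) Y.charpoly.roots).prod ∣
        (Multiset.map (fun _ => q) Y.charpoly.roots).prod := by
      apply Multiset.prod_dvd_prod_of_dvd
      intro l hl
      rw [dvd_iff_isRoot]
      apply h
      rw [← Matrix.eval_charpoly]
      exact (mem_roots'.1 hl).2
    rw [Multiset.map_const', Multiset.prod_replicate, hcard, ← h1] at h3
    exact h3
  obtain ⟨r, hr⟩ := h2
  rw [← map_pow, hr, map_mul, Matrix.aeval_self_charpoly, zero_mul]

open Polynomial in
lemma evalMat_aeval (b : MTuple k n m) (y : MatPoly k n m) (q : (PolyRing k n m)[X]) :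
    evalMat k b (aeval y q) =
      aeval (evalMat k b y) (q.map (polyEval k b : PolyRing k n m →+* k)) := by
  refine Polynomial.map_aeval_eq_aeval_map (ψ := (evalMat k b).toRingHom) ?_ q y
  refine RingHom.ext fun c => ?_
  ext i j
  by_cases hij : i = j
  · simp [evalMat, Matrix.algebraMap_matrix_apply, hij]
  · simp [evalMat, Matrix.algebraMap_matrix_apply, hij]

theorem part_b_T (hn : 1 ≤ n) {X : Set (MTuple k n m)} (hX : IsNVariety k X) :
    X = zeroLocus k (vanishSet k (TMN k n m) X) := by
  obtain ⟨hU, hinv, C, ⟨S, rfl⟩, hXC⟩ := hX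
  apply Set.Subset.antisymm
  · exact fun a ha => ⟨hU ha, fun p hp => hp.2 a ha⟩
  intro a ha
  by_contra haX
  have haU := ha.1
  obtain ⟨f, hfS, hfa⟩ : ∃ f ∈ S, polyEval k a f ≠ 0 := by
    by_contra hcon
    push Not at hcon
    apply haX
    rw [hXC]
    exact ⟨hcon, haU⟩
  have hf : ∀ b ∈ X, polyEval k b f = 0 := by
    intro b hb
    rw [hXC] at hb
    exact hb.1 f hfS
  choose G hG hGa using fun x => exists_eval haU x
  let z : Fin n := ⟨0, hn⟩
  let y := G (Matrix.single z z 1)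
  let w : Fin n → MatPoly k n m := fun i => G (Matrix.single i z 1)
  let w' : Fin n → MatPoly k n m := fun i => G (Matrix.single z i 1)
  have hqC := sepPoly_mem y w w' f (hG _) (fun _ => hG _) (fun _ => hG _)
  set q := sepPoly y w w' f with hq
  have hpT : Polynomial.aeval y q ∈ TMN k n m :=
    aeval_mem_TMN (GMN_le_TMN k n m (hG _)) hqC
  have hvan : (Polynomial.aeval y q) ^ n ∈ vanishSet k (TMN k n m) X := by
    refine ⟨pow_mem hpT n, fun b hb => ?_⟩
    rw [map_pow, evalMat_aeval]
    apply nilp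
    intro l hl
    rw [← evalAt_apply]
    exact sep_vanish hinv y w w' f hf hb l hl
  have h0 := ha.2 _ hvan
  rw [map_pow, evalMat_aeval] at h0
  have hya : evalMat k a y = Matrix.single z z 1 := hGa _
  -- value of the separating polynomial at `(a, 1)`
  have hadj : (Matrix.scalar (Fin n) (1 : k) - evalMat k a y).adjugate = Matrix.single z z 1 := by
    have e1 : Matrix.scalar (Fin n) (1 : k) - evalMat k a y =
        Matrix.diagonal (fun i => if i = z then 0 else 1) := by
      rw [hya]
      ext i j
      by_cases hij : i = j
      · subst hij
        by_cases hi : i = z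
        · subst hi; simp
        · simp [Matrix.single_apply, hi, Ne.symm hi]
      · have : ¬ (z = i ∧ z = j) := fun h => hij (h.1.symm.trans h.2)
        simp [Matrix.single_apply, hij, this]
    rw [e1, Matrix.adjugate_diagonal]
    ext i j
    by_cases hij : i = j
    · subst hij
      rw [Matrix.diagonal_apply_eq]
      by_cases hi : i = z
      · subst hi
        rw [Matrix.single_apply_same]
        apply Finset.prod_eq_one
        intro j hj
        rw [if_neg (Finset.ne_of_mem_erase hj)]
      · rw [Finset.prod_eq_zero (Finset.mem_erase.2 ⟨Ne.symm hi, Finset.mem_univ z⟩) (by simp)]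
        simp [Matrix.single_apply, Ne.symm hi]
    · have : ¬ (z = i ∧ z = j) := fun h => hij (h.1.symm.trans h.2)
      simp [Matrix.single_apply, hij, this]
  have htr : ∀ (M : Matrix (Fin n) (Fin n) k) (i j : Fin n),
      (Matrix.single z i 1 * M * Matrix.single j z 1 * Matrix.single z z 1).trace = M i j := by
    intro M i j
    rw [Matrix.mul_assoc _ (Matrix.single j z (1 : k)), Matrix.single_mul_single_same,
      Matrix.mul_assoc, Matrix.trace_mul_comm, Matrix.mul_assoc, mul_one,
      Matrix.single_mul_single_same, mul_one, Matrix.trace_mul_comm]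
    simp [Matrix.trace_single_mul]
  have hA : (evalAt a 1).mapMatrix (matA y w w') = 1 := by
    ext i j
    have h1 : (evalAt a 1).mapMatrix (matA y w w') i j = evalAt a 1 (trZ y (w' i * w j)) := rfl
    rw [h1, evalAt_trZ, hadj, map_mul, hGa, hGa]
    simpa using htr 1 i j
  have hB : ∀ h, (evalAt a 1).mapMatrix (matB y w w' h) = a h := by
    intro h
    ext i j
    have h1 : (evalAt a 1).mapMatrix (matB y w w' h) i j =
      evalAt a 1 (trZ y (w' i * genericMatrix k n m h * w j)) := rfl
    rw [h1, evalAt_trZ, hadj, map_mul, map_mul, hGa, hGa, evalMat_generic]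
    exact htr _ i j
  have hval : evalAt a 1 q = polyEval k a f := by
    rw [hq, evalAt_sepPoly, hA]
    rw [Matrix.det_one, homog_aeval _ _ one_ne_zero]
    simp only [Matrix.adjugate_one, one_mul, hB, one_pow, inv_one]
    rfl
  rw [evalAt_apply] at hval
  -- eigenvector
  set Y := evalMat k a y with hY
  set r := q.map (polyEval k a : PolyRing k n m →+* k) with hr
  have hev : Y * Matrix.single z z 1 = Matrix.single z z 1 := by
    rw [hya]; simp
  have hev2 : ∀ s : Polynomial k,
      Polynomial.aeval Y s * Matrix.single z z 1 = s.eval 1 • Matrix.single z z (1 : k) := by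
    intro s
    induction s using Polynomial.induction_on' with
    | add p q hp hq => rw [map_add, add_mul, hp, hq, Polynomial.eval_add, add_smul]
    | monomial i c =>
      have : ∀ i : ℕ, Y ^ i * Matrix.single z z 1 = Matrix.single z z 1 := by
        intro i
        induction i with
        | zero => simp
        | succ i ih => rw [pow_succ, mul_assoc, hev, ih]
      rw [Polynomial.aeval_monomial, mul_assoc, this, ← Algebra.smul_def]
      simp
  have h1 := hev2 (r ^ n)
  rw [map_pow, h0, zero_mul, Polynomial.eval_pow, hval] at h1
  have h2 := congrFun (congrFun h1 z) z
  simp at h2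
  exact hfa ((pow_eq_zero_iff (by omega)).1 h2.symm)

end NVar

/-- **Statement 6** (Lemma 1.1).
(a) `Z(J) = Z(J ∩ G_{m,n})` for every ideal `J` of `T_{m,n}`.
(b) If `X ⊆ U_{m,n}` is an `n`-variety, then `X = Z(I(X)) = Z(I_T(X))`. -/
theorem zero_locus_vanishing_ideal (n m : ℕ) (hn : 1 ≤ n) (hm : 2 ≤ m) :
    (∀ J : Set (MatPoly k n m), IsIdealSetOf k (TMN k n m) J →
      zeroLocus k J = zeroLocus k (J ∩ (GMN k n m : Set (MatPoly k n m)))) ∧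
    (∀ X : Set (MTuple k n m), IsNVariety k X →
      X = zeroLocus k (vanishSet k (GMN k n m) X) ∧
      X = zeroLocus k (vanishSet k (TMN k n m) X)) := by
  refine ⟨fun J hJ => NVar.part_a hn J hJ, fun X hX => ?_⟩
  have hT := NVar.part_b_T hn hX
  refine ⟨?_, hT⟩
  have hJ : IsIdealSetOf k (TMN k n m) (vanishSet k (TMN k n m) X) := by
    refine ⟨fun p hp => hp.1, ⟨zero_mem _, fun a _ => map_zero _⟩, ?_, ?_⟩
    · intro p hp q hq
      exact ⟨add_mem hp.1 hq.1, fun a ha => by rw [map_add, hp.2 a ha, hq.2 a ha, add_zero]⟩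
    · intro r hr p hp
      exact ⟨⟨mul_mem hr hp.1, fun a ha => by rw [map_mul, hp.2 a ha, mul_zero]⟩,
        ⟨mul_mem hp.1 hr, fun a ha => by rw [map_mul, hp.2 a ha, zero_mul]⟩⟩
  have h1 := NVar.part_a hn _ hJ
  have h2 : vanishSet k (TMN k n m) X ∩ (GMN k n m : Set (MatPoly k n m)) =
      vanishSet k (GMN k n m) X := by
    ext p
    exact ⟨fun h => ⟨h.2, h.1.2⟩, fun h => ⟨⟨GMN_le_TMN k n m h.1, h.2⟩, h.1⟩⟩
  rw [← h2, ← h1]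
  exact hT

end
end
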